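/- arXiv:1712.04262 — 2 statements merged into one kernel-verified Lean document; each statement's English description precedes it below -/
import Mathlib

section
/- Let K be a field, n > k ≥ 1 integers, R = K[x₁,…,xₙ], and I_{n,k} the ideal generated by all (k+1)-minors of the (k+1)×n Vandermonde matrix M_{n,k}. Then R/I_{n,k} is a Cohen–Macaulay ring. -/
open MvPolynomial

/-- The `(k+1) × n` Vandermonde matrix of variables: the `(i,j)` entry is `xⱼ^i`
(rows indexed by `0,…,k`, columns by the variables `x₁,…,xₙ`). -/
noncomputable def vandermondeMatrix (K : Type*) [Field K] (n k : ℕ) :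
    Matrix (Fin (k + 1)) (Fin n) (MvPolynomial (Fin n) K) :=
  Matrix.of fun i j => (X j : MvPolynomial (Fin n) K) ^ (i : ℕ)

/-- The ideal generated by all maximal (i.e. `(k+1)`-size) minors of the
Vandermonde matrix `vandermondeMatrix K n k`. -/
noncomputable def vanIdeal (K : Type*) [Field K] (n k : ℕ) :
    Ideal (MvPolynomial (Fin n) K) :=
  Ideal.span { d | ∃ g : Fin (k + 1) ↪ Fin n,
    d = ((vandermondeMatrix K n k).submatrix id g).det }

/-- The depth of an ideal `P` in `A`: the supremum of the lengths of regular sequences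
on `A` consisting of elements of `P`. -/
noncomputable def idealDepth {A : Type*} [CommRing A] (P : Ideal A) : ℕ∞ :=
  sSup ((fun s : List A => (s.length : ℕ∞)) ''
    { s | (∀ a ∈ s, a ∈ P) ∧ RingTheory.Sequence.IsRegular A s })

/-- A commutative ring `A` is Cohen–Macaulay if it is Noetherian and, for every maximal
ideal `P`, the maximal length of a regular sequence contained in `P` (the depth of the
local ring `A_P`) equals the height of `P` (the dimension of `A_P`). -/
def IsCohenMacaulayRing (A : Type*) [CommRing A] : Prop :=
  IsNoetherianRing A ∧
  ∀ P : Ideal A, ∀ hP : P.IsMaximal,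
    idealDepth P = Order.height (⟨P, hP.isPrime⟩ : PrimeSpectrum A)

section ExtDepth

universe u

open CategoryTheory Abelian RingTheory.Sequence Pointwise

variable {R : Type u} [CommRing R]

/-- The modules `Extⁱ(R ⧸ I, M)` vanish for all `i < d`. -/
def ExtVanishesBelow (I : Ideal R) (M : Type u) [AddCommGroup M] [Module R M] (d : ℕ) : Prop :=
  ∀ i < d, Subsingleton (Ext (ModuleCat.of R (R ⧸ I)) (ModuleCat.of R M) i)

namespace ExtVanishesBelow

variable {I : Ideal R} {M N L : Type u} [AddCommGroup M] [Module R M] [AddCommGroup N]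
  [Module R N] [AddCommGroup L] [Module R L] {d : ℕ}

theorem zero : ExtVanishesBelow I M 0 := fun i hi => absurd hi (Nat.not_lt_zero i)

theorem mono {e : ℕ} (h : ExtVanishesBelow I M d) (he : e ≤ d) : ExtVanishesBelow I M e :=
  fun i hi => h i (hi.trans_le he)

theorem congr (e : M ≃ₗ[R] N) (h : ExtVanishesBelow I M d) : ExtVanishesBelow I N d := by
  intro i hi
  have := h i hi
  refine ⟨fun x y => ?_⟩
  have key : ∀ z : Ext (ModuleCat.of R (R ⧸ I)) (ModuleCat.of R N) i,
      z = (z.comp (Ext.mk₀ e.toModuleIso.inv) (add_zero i)).comp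
        (Ext.mk₀ e.toModuleIso.hom) (add_zero i) := by
    intro z
    rw [Ext.comp_assoc_of_third_deg_zero, Ext.mk₀_comp_mk₀, Iso.inv_hom_id, Ext.comp_mk₀_id]
  rw [key x, key y]
  congr 1
  exact Subsingleton.elim _ _

variable {f : M →ₗ[R] N} {g : N →ₗ[R] L}

/-- The short exact complex attached to a short exact sequence of linear maps. -/
theorem shortExact (hf : Function.Injective f) (hg : Function.Surjective g)
    (hfg : Function.Exact f g) :
    (ModuleCat.shortComplexOfCompEqZero f g hfg.linearMap_comp_eq_zero).ShortExact where
  exact := ModuleCat.shortComplex_exact _ hfg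
  mono_f := (ModuleCat.mono_iff_injective _).2 hf
  epi_g := (ModuleCat.epi_iff_surjective _).2 hg

theorem right_of_exact (hf : Function.Injective f) (hg : Function.Surjective g)
    (hfg : Function.Exact f g) (hM : ExtVanishesBelow I M (d + 1)) (hN : ExtVanishesBelow I N d) :
    ExtVanishesBelow I L d := by
  intro i hi
  have h1 := hM (i + 1) (by lia)
  have h2 := hN i hi
  refine subsingleton_of_forall_eq 0 fun x => ?_
  obtain ⟨y, rfl⟩ := Ext.covariant_sequence_exact₃ (ModuleCat.of R (R ⧸ I))
    (shortExact hf hg hfg) x rfl (h1.elim _ _)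
  rw [h2.elim y 0, Ext.zero_comp]

theorem left_of_exact (hf : Function.Injective f) (hg : Function.Surjective g)
    (hfg : Function.Exact f g) (hN : ExtVanishesBelow I N (d + 1)) (hL : ExtVanishesBelow I L d) :
    ExtVanishesBelow I M (d + 1) := by
  intro i hi
  have h2 := hN i hi
  refine subsingleton_of_forall_eq 0 fun x => ?_
  cases i with
  | zero =>
    have := Ext.postcomp_mk₀_injective_of_mono (ModuleCat.of R (R ⧸ I))
      (ModuleCat.shortComplexOfCompEqZero f g hfg.linearMap_comp_eq_zero).f
      (hf := (shortExact hf hg hfg).mono_f)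
    exact this (h2.elim _ _)
  | succ i =>
    have h1 := hL i (by lia)
    obtain ⟨y, rfl⟩ := Ext.covariant_sequence_exact₁ (ModuleCat.of R (R ⧸ I))
      (shortExact hf hg hfg) x (h2.elim _ _) rfl
    rw [h1.elim y 0, Ext.zero_comp]

theorem smul_ext_eq_zero {r : R} (hr : r ∈ I) {i : ℕ}
    (x : Ext (ModuleCat.of R (R ⧸ I)) (ModuleCat.of R M) i) :
    x.comp (Ext.mk₀ (r • 𝟙 (ModuleCat.of R M))) (add_zero i) = 0 := by
  rw [← Ext.smul_eq_comp_mk₀]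
  have h0 : r • 𝟙 (ModuleCat.of R (R ⧸ I)) = 0 := by
    refine ModuleCat.hom_ext (LinearMap.ext fun y => ?_)
    obtain ⟨y, rfl⟩ := Ideal.Quotient.mk_surjective y
    change r • (Ideal.Quotient.mk I y) = 0
    rw [← Ideal.Quotient.mk_eq_mk, ← Submodule.Quotient.mk_smul, Ideal.Quotient.mk_eq_mk,
      Ideal.Quotient.eq_zero_iff_mem]
    exact I.mul_mem_right _ hr
  rw [← Ext.mk₀_id_comp x, ← Ext.smul_comp, ← Ext.mk₀_smul, h0, Ext.mk₀_zero, Ext.zero_comp]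

theorem of_isSMulRegular {r : R} (hr : r ∈ I) (hreg : IsSMulRegular M r)
    (h : ExtVanishesBelow I (QuotSMulTop r M) d) : ExtVanishesBelow I M (d + 1) := by
  intro i hi
  refine subsingleton_of_forall_eq 0 fun x => ?_
  have hS := hreg.smulShortComplex_shortExact (M := ModuleCat.of R M)
  have hx : x.comp (Ext.mk₀ (ModuleCat.smulShortComplex (ModuleCat.of R M) r).f)
      (add_zero i) = 0 := smul_ext_eq_zero hr x
  cases i with
  | zero =>
    have := Ext.postcomp_mk₀_injective_of_mono (ModuleCat.of R (R ⧸ I))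
      (ModuleCat.smulShortComplex (ModuleCat.of R M) r).f (hf := hS.mono_f)
    exact this (hx.trans (map_zero _).symm)
  | succ i =>
    obtain ⟨y, rfl⟩ := Ext.covariant_sequence_exact₁ (ModuleCat.of R (R ⧸ I)) hS x hx rfl
    have hy : y = 0 := (h i (by lia)).elim _ _
    rw [hy]
    exact (hS.extClass.postcomp (ModuleCat.of R (R ⧸ I)) rfl).map_zero

theorem quotSMulTop {r : R} (hreg : IsSMulRegular M r) (h : ExtVanishesBelow I M (d + 1)) :
    ExtVanishesBelow I (QuotSMulTop r M) d :=
  right_of_exact (f := LinearMap.lsmul R M r) (g := (r • (⊤ : Submodule R M)).mkQ) hreg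
    (Submodule.mkQ_surjective _) (LinearMap.exact_lsmul_mkQ_smul_top M r) h (h.mono d.le_succ)

end ExtVanishesBelow

open ExtVanishesBelow in
/-- The Rees characterization of depth. -/
theorem extVanishesBelow_iff_exists_isWeaklyRegular [IsNoetherianRing R] (I : Ideal R)
    (M : Type u) [AddCommGroup M] [Module R M] [Module.Finite R M] (d : ℕ) :
    ExtVanishesBelow I M d ↔
      ∃ rs : List R, rs.length = d ∧ (∀ r ∈ rs, r ∈ I) ∧ IsWeaklyRegular M rs := by
  induction d generalizing M with
  | zero => exact ⟨fun _ => ⟨[], rfl, by simp, .nil R M⟩, fun _ => zero⟩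
  | succ d ih =>
    constructor
    · intro h
      have h0 := h 0 d.succ_pos
      have : Subsingleton ((R ⧸ I) →ₗ[R] M) := by
        have h1 : Subsingleton (ModuleCat.of R (R ⧸ I) ⟶ ModuleCat.of R M) :=
          Ext.homEquiv₀.symm.subsingleton
        exact (ModuleCat.homEquiv (M := ModuleCat.of R (R ⧸ I))
          (N := ModuleCat.of R M)).symm.subsingleton
      obtain ⟨r, hr, hreg⟩ := IsSMulRegular.subsingleton_linearMap_iff.1 this
      rw [Ideal.annihilator_quotient] at hr
      obtain ⟨rs, hl, hmem, hrs⟩ := (ih (QuotSMulTop r M)).1 (h.quotSMulTop hreg)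
      exact ⟨r :: rs, by simp [hl], by simpa [hr] using hmem, .cons hreg hrs⟩
    · rintro ⟨rs, hl, hmem, hrs⟩
      cases rs with
      | nil => simp at hl
      | cons r rs =>
        rw [isWeaklyRegular_cons_iff] at hrs
        exact of_isSMulRegular (hmem r (by simp)) hrs.1
          ((ih _).2 ⟨rs, by simpa using hl, fun s hs => hmem s (by simp [hs]), hrs.2⟩)

end ExtDepth

section RingDepth

universe u

open RingTheory.Sequence Pointwise

/-- Every maximal ideal of `R` contains a weakly regular sequence on `R` of length `d`. -/
def MaximalDepthGE (R : Type u) [CommRing R] (d : ℕ) : Prop :=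
  ∀ P : Ideal R, P.IsMaximal →
    ∃ rs : List R, rs.length = d ∧ (∀ r ∈ rs, r ∈ P) ∧ IsWeaklyRegular R rs

theorem exists_isWeaklyRegular_length (R : Type*) [CommRing R] (M : Type*) [AddCommGroup M]
    [Module R M] (d : ℕ) : ∃ rs : List R, rs.length = d ∧ IsWeaklyRegular M rs := by
  induction d generalizing M with
  | zero => exact ⟨[], rfl, .nil R M⟩
  | succ d ih =>
    obtain ⟨rs, hl, hrs⟩ := ih (QuotSMulTop (1 : R) M)
    exact ⟨1 :: rs, by simp [hl], .cons (IsSMulRegular.one M) hrs⟩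

theorem exists_list_map_eq_of_forall_mem_map {R S : Type*} [CommRing R] [CommRing S] {f : R →+* S}
    (hf : Function.Surjective f) (P : Ideal R) (ss : List S) (h : ∀ s ∈ ss, s ∈ P.map f) :
    ∃ rs : List R, rs.map f = ss ∧ ∀ r ∈ rs, r ∈ P := by
  induction ss with
  | nil => exact ⟨[], rfl, by simp⟩
  | cons s ss ih =>
    obtain ⟨rs, h1, h2⟩ := ih fun t ht => h t (by simp [ht])
    obtain ⟨r, hr, rfl⟩ := (Ideal.mem_map_iff_of_surjective f hf).1 (h s (by simp))
    exact ⟨r :: rs, by simp [h1], by simpa [hr] using h2⟩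

namespace MaximalDepthGE

variable {R S T : Type u} [CommRing R] [CommRing S] [CommRing T] {d : ℕ}

theorem zero : MaximalDepthGE R 0 := fun _ _ => ⟨[], rfl, by simp, .nil R R⟩

theorem of_ringEquiv (e : R ≃+* S) (h : MaximalDepthGE R d) : MaximalDepthGE S d := by
  intro P hP
  obtain ⟨rs, hl, hmem, hrs⟩ := h (P.comap (e : R →+* S))
    (Ideal.comap_isMaximal_of_surjective _ e.surjective)
  refine ⟨rs.map e, by simpa using hl, by simpa using hmem, ?_⟩
  refine (AddEquiv.isWeaklyRegular_congr (e := e.toAddEquiv) (as := rs) ?_).1 hrs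
  rw [List.forall₂_map_right_iff]
  exact List.forall₂_same.2 fun a _ x => by simp

/-- The depth condition on `R ⧸ J`, read off over `R`. -/
theorem extVanishesBelow [IsNoetherianRing R] {J : Ideal R} (h : MaximalDepthGE (R ⧸ J) d)
    (P : Ideal R) (hP : P.IsMaximal) : ExtVanishesBelow P (R ⧸ J) d := by
  rw [extVanishesBelow_iff_exists_isWeaklyRegular]
  have hsurj := Ideal.Quotient.mk_surjective (I := J)
  obtain ⟨ss, hl, hmem, hss⟩ : ∃ ss : List (R ⧸ J), ss.length = d ∧
      (∀ s ∈ ss, s ∈ P.map (Ideal.Quotient.mk J)) ∧ IsWeaklyRegular (R ⧸ J) ss := by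
    rcases Ideal.map_eq_top_or_isMaximal_of_surjective _ hsurj hP with htop | hmax
    · obtain ⟨ss, hl, hss⟩ := exists_isWeaklyRegular_length (R ⧸ J) (R ⧸ J) d
      exact ⟨ss, hl, by simp [htop], hss⟩
    · exact h _ hmax
  obtain ⟨rs, rfl, hrs⟩ := exists_list_map_eq_of_forall_mem_map hsurj P ss hmem
  exact ⟨rs, by simpa using hl, hrs, (isWeaklyRegular_map_algebraMap_iff (R ⧸ J) (R ⧸ J) rs).1 hss⟩

theorem of_forall_extVanishesBelow [IsNoetherianRing R] {J : Ideal R}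
    (h : ∀ P : Ideal R, P.IsMaximal → ExtVanishesBelow P (R ⧸ J) d) :
    MaximalDepthGE (R ⧸ J) d := by
  intro P hP
  have hsurj := Ideal.Quotient.mk_surjective (I := J)
  obtain ⟨rs, hl, hmem, hrs⟩ := (extVanishesBelow_iff_exists_isWeaklyRegular _ _ _).1
    (h (P.comap (Ideal.Quotient.mk J)) (Ideal.comap_isMaximal_of_surjective _ hsurj))
  exact ⟨rs.map (algebraMap R (R ⧸ J)), by simpa using hl, by simpa using hmem,
    (isWeaklyRegular_map_algebraMap_iff (R ⧸ J) (R ⧸ J) rs).2 hrs⟩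

/-- Linkage of depth along an isomorphism `J₁ / J₀ ≃ J₂ / J₀` given by multiplication by a
nonzerodivisor `h` in an overring `T` of `R ⧸ J₀`. -/
theorem quotient_of_mul [IsNoetherianRing R] (Φ : R →+* T) {t : T} (ht : t ∈ nonZeroDivisors T)
    {J₀ J₁ J₂ : Ideal R} (hJ₀ : RingHom.ker Φ = J₀) (h₁ : J₀ ≤ J₁) (h₂ : J₀ ≤ J₂)
    (h₁₂ : ∀ a ∈ J₁, ∃ b ∈ J₂, Φ b = t * Φ a) (h₂₁ : ∀ b ∈ J₂, ∃ a ∈ J₁, Φ b = t * Φ a)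
    (hd₀ : MaximalDepthGE (R ⧸ J₀) (d + 1)) (hd₁ : MaximalDepthGE (R ⧸ J₁) d) :
    MaximalDepthGE (R ⧸ J₂) d := by
  let : Algebra R T := Φ.toAlgebra
  have hker : LinearMap.ker (Algebra.linearMap R T) = J₀ := hJ₀
  let φ : (R ⧸ J₀) →ₗ[R] T := Submodule.liftQ J₀ (Algebra.linearMap R T) hker.ge
  have hφ : Function.Injective φ := LinearMap.ker_eq_bot.1
    (Submodule.ker_liftQ_eq_bot _ _ _ hker.le)
  let μ : T →ₗ[R] T := LinearMap.mulLeft R t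
  have hμ : Function.Injective μ := fun x y hxy => by
    simpa [μ, ht] using hxy
  let N₁ : Submodule R (R ⧸ J₀) := Submodule.map J₀.mkQ J₁
  let N₂ : Submodule R (R ⧸ J₀) := Submodule.map J₀.mkQ J₂
  have hN : (N₁.map φ).map μ = N₂.map φ := by
    have hc : φ ∘ₗ J₀.mkQ = Algebra.linearMap R T := Submodule.liftQ_mkQ _ _ _
    simp only [N₁, N₂, ← Submodule.map_comp, hc]
    ext x
    simp only [Submodule.mem_map]
    constructor
    · rintro ⟨a, ha, rfl⟩
      obtain ⟨b, hb, hab⟩ := h₁₂ a ha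
      exact ⟨b, hb, hab⟩
    · rintro ⟨b, hb, rfl⟩
      obtain ⟨a, ha, hab⟩ := h₂₁ b hb
      exact ⟨a, ha, hab.symm⟩
  let e : N₁ ≃ₗ[R] N₂ := (Submodule.equivMapOfInjective φ hφ N₁).trans
    ((Submodule.equivMapOfInjective μ hμ _).trans
      ((LinearEquiv.ofEq _ _ hN).trans (Submodule.equivMapOfInjective φ hφ N₂).symm))
  refine of_forall_extVanishesBelow fun P hP => ?_
  have key : ∀ N : Submodule R (R ⧸ J₀), Function.Exact N.subtype N.mkQ := fun N =>
    LinearMap.exact_subtype_mkQ N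
  have e₁ : ExtVanishesBelow P N₁ (d + 1) :=
    .left_of_exact N₁.injective_subtype N₁.mkQ_surjective (key N₁) (hd₀.extVanishesBelow P hP)
      ((hd₁.extVanishesBelow P hP).congr (Submodule.quotientQuotientEquivQuotient J₀ J₁ h₁).symm)
  exact (ExtVanishesBelow.right_of_exact N₂.injective_subtype N₂.mkQ_surjective (key N₂)
    (e₁.congr e) ((hd₀.extVanishesBelow P hP).mono d.le_succ)).congr
      (Submodule.quotientQuotientEquivQuotient J₀ J₂ h₂)

/-- Adjoining a polynomial variable to a finitely generated algebra raises the depth by one. -/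
theorem polynomial (K : Type u) [Field K] [Algebra K R] [Algebra.FiniteType K R]
    (h : MaximalDepthGE R d) : MaximalDepthGE (Polynomial R) (d + 1) := by
  intro P hP
  have : IsJacobsonRing R := isJacobsonRing_of_finiteType (A := K)
  obtain ⟨rs, hl, hmem, hrs⟩ := h (P.comap (Polynomial.C : R →+* Polynomial R))
    (Polynomial.isMaximal_comap_C_of_isJacobsonRing P)
  obtain ⟨g, hg, hgP⟩ : ∃ g : Polynomial R, g.Monic ∧ g ∈ P := by
    let : Field (Polynomial R ⧸ P) := Ideal.Quotient.field P
    have : Algebra.FiniteType K (Polynomial R) := .trans (S := R) inferInstance inferInstance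
    have : Module.Finite K (Polynomial R ⧸ P) :=
      finite_of_finite_type_of_isJacobsonRing K (Polynomial R ⧸ P)
    obtain ⟨p, hp, hp0⟩ := Algebra.IsIntegral.isIntegral (R := K) (Ideal.Quotient.mk P Polynomial.X)
    refine ⟨p.map (algebraMap K R), hp.map _, ?_⟩
    rw [← Ideal.Quotient.eq_zero_iff_mem, ← hp0]
    have : p.map (algebraMap K R) = Polynomial.aeval (Polynomial.X : Polynomial R) p := by
      rw [Polynomial.aeval_def, Polynomial.map, Polynomial.eval₂_eq_sum,
        Polynomial.eval₂_eq_sum]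
      rfl
    rw [this, ← Polynomial.aeval_def, ← Ideal.Quotient.mkₐ_eq_mk K P,
      Polynomial.aeval_algHom_apply]
  refine ⟨rs.map Polynomial.C ++ [g], by simp [hl], ?_, ?_⟩
  · intro r hr
    simp only [List.mem_append, List.mem_map, List.mem_singleton] at hr
    rcases hr with ⟨s, hs, rfl⟩ | rfl
    · exact hmem s hs
    · exact hgP
  · rw [isWeaklyRegular_append_iff, isWeaklyRegular_singleton_iff]
    refine ⟨hrs.of_flat (S := Polynomial R), ?_⟩
    rw [isSMulRegular_iff_right_eq_zero_of_smul]
    intro x hx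
    obtain ⟨f, rfl⟩ := Submodule.Quotient.mk_surjective _ x
    rw [← Submodule.Quotient.mk_smul] at hx
    rw [Submodule.Quotient.mk_eq_zero] at hx ⊢
    rw [← Ideal.map_ofList, smul_eq_mul, Ideal.mul_top] at hx ⊢
    set J : Ideal R := Ideal.ofList rs
    rw [← Ideal.mk_ker (I := J), ← Polynomial.ker_mapRingHom, RingHom.mem_ker,
      Polynomial.coe_mapRingHom] at hx ⊢
    rw [smul_eq_mul, Polynomial.map_mul] at hx
    exact ((hg.map (Ideal.Quotient.mk J)).mul_right_eq_zero_iff).1 hx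

end MaximalDepthGE

end RingDepth

section Vandermonde

variable (K : Type*) [Field K]

/-- The ideal generated by the Vandermonde determinants of all `(k+1)`-tuples of variables,
repetitions being allowed. -/
noncomputable def vandermondeIdeal (n k : ℕ) : Ideal (MvPolynomial (Fin n) K) :=
  Ideal.span (Set.range fun g : Fin (k + 1) → Fin n =>
    (Matrix.vandermonde fun i => (X (g i) : MvPolynomial (Fin n) K)).det)

theorem vanIdeal_eq_vandermondeIdeal (n k : ℕ) : vanIdeal K n k = vandermondeIdeal K n k := by
  have hdet : ∀ g : Fin (k + 1) → Fin n, ((vandermondeMatrix K n k).submatrix id g).det =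
      (Matrix.vandermonde fun i => (X (g i) : MvPolynomial (Fin n) K)).det := by
    intro g
    rw [← Matrix.det_transpose]
    rfl
  refine le_antisymm (Ideal.span_le.2 ?_) (Ideal.span_le.2 ?_)
  · rintro _ ⟨g, rfl⟩
    rw [hdet]
    exact Ideal.subset_span ⟨g, rfl⟩
  · rintro _ ⟨g, rfl⟩
    by_cases hg : Function.Injective g
    · exact Ideal.subset_span ⟨⟨g, hg⟩, (hdet g).symm⟩
    · have h0 : (Matrix.vandermonde fun i => (X (g i) : MvPolynomial (Fin n) K)).det = 0 := by
        by_contra h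
        rw [← ne_eq, Matrix.det_vandermonde_ne_zero_iff] at h
        exact hg fun a b hab => h (congrArg X hab)
      simp only [h0]
      exact zero_mem _

variable {K} {n k : ℕ}

theorem rename_det_vandermonde {m : ℕ} (π : Fin n → Fin k) (g : Fin m → Fin n) :
    rename π (Matrix.vandermonde fun i => (X (g i) : MvPolynomial (Fin n) K)).det =
      (Matrix.vandermonde fun i => (X (π (g i)) : MvPolynomial (Fin k) K)).det := by
  simp [Matrix.det_vandermonde]

theorem injective_of_det_vandermonde_ne_zero {m : ℕ} {g : Fin m → Fin n}
    (h : (Matrix.vandermonde fun i => (X (g i) : MvPolynomial (Fin n) K)).det ≠ 0) :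
    Function.Injective g := by
  rw [Matrix.det_vandermonde_ne_zero_iff] at h
  exact fun a b hab => h (congrArg X hab)

theorem rename_eq_zero_of_mem_vandermondeIdeal {f : MvPolynomial (Fin n) K}
    (hf : f ∈ vandermondeIdeal K n k) (π : Fin n → Fin k) : rename π f = 0 := by
  suffices vandermondeIdeal K n k ≤ RingHom.ker (rename (R := K) π) from this hf
  refine Ideal.span_le.2 ?_
  rintro _ ⟨g, rfl⟩
  rw [SetLike.mem_coe, RingHom.mem_ker, rename_det_vandermonde]
  by_contra h
  have := Fintype.card_le_of_injective _ (injective_of_det_vandermonde_ne_zero h)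
  simp at this

variable (K n k) in
/-- The images of a polynomial with coefficients in `K[x₁,…,xₙ]` under all specializations of the
variables to `k` variables. -/
noncomputable def specialize : Polynomial (MvPolynomial (Fin n) K) →+*
    ((Fin n → Fin k) → Polynomial (MvPolynomial (Fin k) K)) :=
  RingHom.pi fun π => Polynomial.mapRingHom (rename π : _ →ₐ[K] _).toRingHom

theorem specialize_apply (f : Polynomial (MvPolynomial (Fin n) K)) (π : Fin n → Fin k) :
    specialize K n k f π = f.map (rename π : _ →ₐ[K] _).toRingHom := rfl

variable (K n k) in
/-- The polynomial `∏ (x - tⱼ)` in every component. -/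
noncomputable def specializeRoots : (Fin n → Fin k) → Polynomial (MvPolynomial (Fin k) K) :=
  fun _ => ∏ j, (Polynomial.X - Polynomial.C (X j))

theorem specializeRoots_mem_nonZeroDivisors :
    specializeRoots K n k ∈ nonZeroDivisors
      ((Fin n → Fin k) → Polynomial (MvPolynomial (Fin k) K)) := by
  have h0 : (∏ j : Fin k, (Polynomial.X - Polynomial.C (X j : MvPolynomial (Fin k) K))) ≠ 0 :=
    Finset.prod_ne_zero_iff.2 fun j _ => Polynomial.X_sub_C_ne_zero _
  rw [mem_nonZeroDivisors_iff_right]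
  intro x hx
  funext π
  exact (mul_eq_zero.1 (congrFun hx π)).resolve_right h0

theorem ker_specialize_of_mem_iff
    (h : ∀ f : MvPolynomial (Fin n) K, (∀ π : Fin n → Fin k, rename π f = 0) →
      f ∈ vandermondeIdeal K n k) :
    RingHom.ker (specialize K n k) = (vandermondeIdeal K n k).map Polynomial.C := by
  ext f
  rw [Ideal.mem_map_C_iff, RingHom.mem_ker]
  constructor
  · intro hf i
    refine h _ fun π => ?_
    have := congrArg (fun q => q.coeff i) (congrFun hf π)
    simpa [specialize_apply] using this
  · intro hf
    funext π
    ext1 i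
    simpa [specialize_apply] using rename_eq_zero_of_mem_vandermondeIdeal (hf i) π

variable (K n k) in
/-- The Vandermonde ideal in `n + 1` variables, as an ideal of polynomials in the first one. -/
noncomputable def succVandermondeIdeal : Ideal (Polynomial (MvPolynomial (Fin n) K)) :=
  (vandermondeIdeal K (n + 1) k).map (finSuccEquiv K n)

theorem mem_succVandermondeIdeal_iff {f : MvPolynomial (Fin (n + 1)) K} :
    finSuccEquiv K n f ∈ succVandermondeIdeal K n k ↔ f ∈ vandermondeIdeal K (n + 1) k := by
  constructor
  · intro h
    obtain ⟨g, hg, hgf⟩ := (Ideal.mem_map_iff_of_surjective (finSuccEquiv K n)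
      (finSuccEquiv K n).surjective).1 h
    rwa [← (finSuccEquiv K n).injective hgf]
  · exact fun h => Ideal.mem_map_of_mem (finSuccEquiv K n) h

theorem map_C_vandermondeIdeal_le : (vandermondeIdeal K n k).map Polynomial.C ≤
    succVandermondeIdeal K n k := by
  rw [vandermondeIdeal, Ideal.map_span, Ideal.span_le]
  rintro _ ⟨_, ⟨g, rfl⟩, rfl⟩
  have : Polynomial.C (Matrix.vandermonde fun i => (X (g i) : MvPolynomial (Fin n) K)).det =
      finSuccEquiv K n (Matrix.vandermonde fun i => X (g i).succ).det := by
    simp [Matrix.det_vandermonde, finSuccEquiv_X_succ]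
  rw [this]
  exact mem_succVandermondeIdeal_iff.2 (Ideal.subset_span ⟨fun i => (g i).succ, rfl⟩)

theorem associated_prod_sub_comm {A : Type*} [CommRing A] {m : ℕ} (a b : Fin m → A) :
    Associated (∏ j, (a j - b j)) (∏ j, (b j - a j)) :=
  Associated.prod _ _ _ fun j _ => ⟨-1, by simp⟩

theorem associated_finSuccEquiv_det_vandermonde_cons (g : Fin (k + 1) → Fin n) :
    Associated (finSuccEquiv K n (Matrix.vandermonde fun i =>
      X ((Fin.cons 0 (Fin.succ ∘ g) : Fin (k + 2) → Fin (n + 1)) i)).det)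
    (Polynomial.C (Matrix.vandermonde fun i => (X (g i) : MvPolynomial (Fin n) K)).det *
      ∏ j, (Polynomial.X - Polynomial.C (X (g j)))) := by
  have h := (associated_prod_sub_comm (fun j => Polynomial.C (X (g j) : MvPolynomial (Fin n) K))
    fun _ => Polynomial.X).mul_left
      (Polynomial.C (Matrix.vandermonde fun i => (X (g i) : MvPolynomial (Fin n) K)).det)
  convert h using 1
  rw [mul_comm, Matrix.det_vandermonde, Matrix.det_vandermonde,
    Fin.prod_univ_succ, Fin.prod_Ioi_zero]
  simp_rw [Fin.prod_Ioi_succ]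
  simp [finSuccEquiv_X_succ, finSuccEquiv_X_zero]

theorem specialize_C_det_mul_prod (g : Fin k → Fin n) :
    specialize K n k
      (Polynomial.C (Matrix.vandermonde fun i => (X (g i) : MvPolynomial (Fin n) K)).det *
        ∏ j, (Polynomial.X - Polynomial.C (X (g j)))) =
    specializeRoots K n k *
      specialize K n k (Polynomial.C (Matrix.vandermonde fun i => X (g i)).det) := by
  rw [map_mul, mul_comm]
  funext π
  simp only [Pi.mul_apply, specialize_apply, Polynomial.map_C, AlgHom.toRingHom_eq_coe,
    RingHom.coe_coe, rename_det_vandermonde]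
  by_cases h : (Matrix.vandermonde fun i => (X (π (g i)) : MvPolynomial (Fin k) K)).det = 0
  · simp [h]
  · have hb : Function.Bijective (π ∘ g) :=
      Finite.injective_iff_bijective.1 (injective_of_det_vandermonde_ne_zero h)
    congr 1
    simp only [Polynomial.map_prod, Polynomial.map_sub, Polynomial.map_X, Polynomial.map_C,
      RingHom.coe_coe, rename_X, specializeRoots]
    exact hb.prod_comp fun j => Polynomial.X - Polynomial.C (X j : MvPolynomial (Fin k) K)

theorem C_det_mul_prod_mem (g : Fin (k + 1) → Fin n) :
    Polynomial.C (Matrix.vandermonde fun i => (X (g i) : MvPolynomial (Fin n) K)).det *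
      ∏ j, (Polynomial.X - Polynomial.C (X (g j))) ∈ succVandermondeIdeal K n (k + 1) := by
  refine Ideal.mem_of_dvd _ (associated_finSuccEquiv_det_vandermonde_cons g).dvd ?_
  exact mem_succVandermondeIdeal_iff.2 (Ideal.subset_span ⟨_, rfl⟩)

/-- The generators of the Vandermonde ideal in `n + 1` variables, sorted by whether they involve
the first variable. -/
theorem succVandermondeIdeal_le {J : Ideal (Polynomial (MvPolynomial (Fin n) K))}
    (h₀ : (vandermondeIdeal K n (k + 1)).map Polynomial.C ≤ J)
    (h₁ : ∀ g : Fin (k + 1) → Fin n,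
      Polynomial.C (Matrix.vandermonde fun i => (X (g i) : MvPolynomial (Fin n) K)).det *
        ∏ j, (Polynomial.X - Polynomial.C (X (g j))) ∈ J) :
    succVandermondeIdeal K n (k + 1) ≤ J := by
  rw [succVandermondeIdeal, vandermondeIdeal, Ideal.map_span, Ideal.span_le]
  rintro _ ⟨_, ⟨g, rfl⟩, rfl⟩
  rw [SetLike.mem_coe]
  beta_reduce
  by_cases hg : Function.Injective g
  swap
  · rw [not_not.1 (mt injective_of_det_vandermonde_ne_zero hg), map_zero]
    exact zero_mem _
  by_cases h0 : ∃ i, g i = 0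
  · obtain ⟨i, hi⟩ := h0
    let σ : Equiv.Perm (Fin (k + 2)) := Equiv.swap 0 i
    have hσ : ∀ j : Fin (k + 1), g (σ j.succ) ≠ 0 := by
      intro j hj
      have h1 : σ j.succ = σ 0 := by
        rw [Equiv.swap_apply_left]; exact hg (hj.trans hi.symm)
      exact Fin.succ_ne_zero j (σ.injective h1)
    let g' : Fin (k + 1) → Fin n := fun j => (g (σ j.succ)).pred (hσ j)
    have hg' : (Fin.cons 0 (Fin.succ ∘ g') : Fin (k + 2) → Fin (n + 1)) = g ∘ σ := by
      funext j
      refine Fin.cases ?_ (fun j => ?_) j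
      · simp [σ, hi]
      · simp [g']
    have hperm := Matrix.det_permute σ
      (Matrix.vandermonde fun i => (X (g i) : MvPolynomial (Fin (n + 1)) K))
    have hsub : (Matrix.vandermonde fun i => (X (g i) : MvPolynomial (Fin (n + 1)) K)).submatrix
        σ id = Matrix.vandermonde fun i =>
          X ((Fin.cons 0 (Fin.succ ∘ g') : Fin (k + 2) → Fin (n + 1)) i) := by
      rw [hg']; rfl
    rw [hsub] at hperm
    have hmem : finSuccEquiv K n (Matrix.vandermonde fun i =>
        X ((Fin.cons 0 (Fin.succ ∘ g') : Fin (k + 2) → Fin (n + 1)) i)).det ∈ J :=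
      J.mem_of_dvd (associated_finSuccEquiv_det_vandermonde_cons g').symm.dvd (h₁ g')
    rw [hperm, map_mul] at hmem
    exact (Ideal.unit_mul_mem_iff_mem _
      (((Equiv.Perm.sign σ).isUnit.map (Int.castRingHom _)).map (finSuccEquiv K n))).1 hmem
  · push Not at h0
    have : finSuccEquiv K n (Matrix.vandermonde fun i => X (g i)).det =
        Polynomial.C (Matrix.vandermonde fun i =>
          (X ((g i).pred (h0 i)) : MvPolynomial (Fin n) K)).det := by
      have : ∀ i, finSuccEquiv K n (X (g i)) = Polynomial.C (X ((g i).pred (h0 i))) := by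
        intro i
        rw [← finSuccEquiv_X_succ, Fin.succ_pred]
      simp [Matrix.det_vandermonde, this]
    rw [this]
    exact h₀ (Ideal.mem_map_of_mem _ (Ideal.subset_span ⟨fun i => (g i).pred (h0 i), rfl⟩))

theorem eval_map_rename_finSuccEquiv (f : MvPolynomial (Fin (n + 1)) K) (π : Fin n → Fin k)
    (j : Fin k) :
    ((finSuccEquiv K n f).map (rename π : _ →ₐ[K] _).toRingHom).eval (X j) =
      rename (Fin.cons j π : Fin (n + 1) → Fin k) f := by
  induction f using MvPolynomial.induction_on with
  | C a => simp [finSuccEquiv_apply, algHom_C]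
  | add p q hp hq => simp only [map_add, Polynomial.map_add, Polynomial.eval_add, hp, hq]
  | mul_X p i hp =>
    rw [map_mul, Polynomial.map_mul, Polynomial.eval_mul, hp, map_mul]
    refine Fin.cases ?_ (fun i => ?_) i <;> simp [finSuccEquiv_X_zero, finSuccEquiv_X_succ]

theorem eval_map_rename_eq_zero_of_mem {F : Polynomial (MvPolynomial (Fin n) K)}
    (hF : F ∈ succVandermondeIdeal K n k) (π : Fin n → Fin k) (j : Fin k) :
    (F.map (rename π : _ →ₐ[K] _).toRingHom).eval (X j) = 0 := by
  obtain ⟨f, rfl⟩ := (finSuccEquiv K n).surjective F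
  rw [eval_map_rename_finSuccEquiv]
  exact rename_eq_zero_of_mem_vandermondeIdeal (mem_succVandermondeIdeal_iff.1 hF) _

theorem rename_coeff_eq_zero {F : Polynomial (MvPolynomial (Fin n) K)}
    (hF : ∀ (π : Fin n → Fin (k + 1)) (j : Fin (k + 1)),
      (F.map (rename π : _ →ₐ[K] _).toRingHom).eval (X j) = 0)
    (π : Fin n → Fin k) (i : ℕ) : rename π (F.coeff i) = 0 := by
  have h : ∀ G : Polynomial (MvPolynomial (Fin n) K),
      finSuccEquiv K k ((G.map (rename (Fin.succ ∘ π) : _ →ₐ[K] _).toRingHom).eval (X 0)) =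
        G.map (rename π : _ →ₐ[K] _).toRingHom := by
    intro G
    have hC : ∀ p : MvPolynomial (Fin n) K, finSuccEquiv K k (rename (Fin.succ ∘ π) p) =
        Polynomial.C (rename π p) := by
      intro p
      induction p using MvPolynomial.induction_on with
      | C a => simp [finSuccEquiv_apply, algHom_C]
      | add p q hp hq => simp only [map_add, hp, hq]
      | mul_X p i hp =>
        rw [map_mul, map_mul, hp, map_mul, map_mul]
        simp [finSuccEquiv_X_succ]
    induction G using Polynomial.induction_on' with
    | add p q hp hq => simp only [map_add, Polynomial.map_add, Polynomial.eval_add, hp, hq]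
    | monomial d a =>
      rw [Polynomial.map_monomial, Polynomial.eval_monomial, map_mul, map_pow,
        finSuccEquiv_X_zero, AlgHom.toRingHom_eq_coe, RingHom.coe_coe, hC,
        Polynomial.C_mul_X_pow_eq_monomial, Polynomial.map_monomial]
      rfl
  have h0 := h F
  rw [hF, map_zero] at h0
  simpa using (congrArg (fun q => q.coeff i) h0).symm

/-- Every element of the Vandermonde ideal in `n` variables is the leading coefficient of a
polynomial of degree `k + 1` in the Vandermonde ideal in `n + 1` variables. -/
theorem exists_C_mul_X_pow_add_mem {a : MvPolynomial (Fin n) K} (ha : a ∈ vandermondeIdeal K n k) :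
    ∃ r ∈ Polynomial.degreeLT (MvPolynomial (Fin n) K) (k + 1),
      Polynomial.C a * Polynomial.X ^ (k + 1) + r ∈ succVandermondeIdeal K n (k + 1) := by
  induction ha using Submodule.span_induction with
  | mem a ha =>
    obtain ⟨g, rfl⟩ := ha
    set Q : Polynomial (MvPolynomial (Fin n) K) :=
      ∏ j, (Polynomial.X - Polynomial.C (X (g j))) with hQ
    have hm : Q.Monic := Polynomial.monic_prod_of_monic _ _ fun j _ => Polynomial.monic_X_sub_C _
    have hd : Q.degree = (k + 1 : ℕ) := by
      rw [hQ, Polynomial.degree_prod]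
      simp
    refine ⟨Polynomial.C (Matrix.vandermonde fun i => (X (g i) : MvPolynomial (Fin n) K)).det *
      (Q - Polynomial.X ^ (k + 1)), ?_, ?_⟩
    · rw [← Polynomial.smul_eq_C_mul]
      refine Submodule.smul_mem _ _ (Polynomial.mem_degreeLT.2 ?_)
      rw [← hd]
      exact Polynomial.degree_sub_lt_left (by rw [hd, Polynomial.degree_X_pow]) hm.ne_zero
        (by rw [hm.leadingCoeff, Polynomial.leadingCoeff_X_pow])
    · beta_reduce
      rw [← mul_add, add_sub_cancel]
      exact C_det_mul_prod_mem g
  | zero => exact ⟨0, zero_mem _, by simp⟩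
  | add a b _ _ ha hb =>
    obtain ⟨r, hr, har⟩ := ha
    obtain ⟨s, hs, hbs⟩ := hb
    refine ⟨r + s, add_mem hr hs, ?_⟩
    rw [Polynomial.C_add, add_mul, add_add_add_comm]
    exact add_mem har hbs
  | smul c a _ ha =>
    obtain ⟨r, hr, har⟩ := ha
    refine ⟨c • r, Submodule.smul_mem _ _ hr, ?_⟩
    rw [smul_eq_mul, Polynomial.C_mul, mul_assoc, Polynomial.smul_eq_C_mul, ← mul_add]
    exact Ideal.mul_mem_left _ _ har

theorem mem_succVandermondeIdeal_of_eval_map_rename_eq_zero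
    (ih : ∀ (k : ℕ) (f : MvPolynomial (Fin n) K), (∀ π : Fin n → Fin k, rename π f = 0) →
      f ∈ vandermondeIdeal K n k) (d : ℕ) {F : Polynomial (MvPolynomial (Fin n) K)}
    (hd : ∀ i, k + 1 + d ≤ i → F.coeff i = 0)
    (hF : ∀ (π : Fin n → Fin (k + 1)) (j : Fin (k + 1)),
      (F.map (rename π : _ →ₐ[K] _).toRingHom).eval (X j) = 0) :
    F ∈ succVandermondeIdeal K n (k + 1) := by
  induction d generalizing F with
  | zero =>
    refine map_C_vandermondeIdeal_le (Ideal.mem_map_C_iff.2 fun i => ih _ _ fun π => ?_)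
    have h0 : F.map (rename π : _ →ₐ[K] _).toRingHom = 0 := by
      refine Polynomial.eq_zero_of_degree_lt_of_eval_index_eq_zero
        (s := Finset.univ) (v := fun j => (X j : MvPolynomial (Fin (k + 1)) K))
        (X_injective.injOn) ?_ fun j _ => hF π j
      refine Polynomial.degree_map_le.trans_lt ?_
      rw [Polynomial.degree_lt_iff_coeff_zero]
      simpa using hd
    simpa using congrArg (fun q => q.coeff i) h0
  | succ d hind =>
    obtain ⟨r, hr, hmem⟩ := exists_C_mul_X_pow_add_mem
      (ih _ _ fun π => rename_coeff_eq_zero hF π (k + 1 + d))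
    rw [Polynomial.mem_degreeLT, Polynomial.degree_lt_iff_coeff_zero] at hr
    have hG := Ideal.mul_mem_right (Polynomial.X ^ d) _ hmem
    rw [← sub_add_cancel F ((_ + r) * Polynomial.X ^ d)]
    refine add_mem (hind (fun i hi => ?_) fun π j => ?_) hG
    · obtain ⟨e, rfl⟩ := Nat.exists_eq_add_of_le hi
      rw [Polynomial.coeff_sub, show k + 1 + d + e = k + 1 + e + d by ring,
        Polynomial.coeff_mul_X_pow, Polynomial.coeff_add, hr _ (by omega), add_zero,
        Polynomial.coeff_C_mul, Polynomial.coeff_X_pow]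
      rcases Nat.eq_zero_or_pos e with rfl | he
      · simp
      · rw [hd _ (by omega), if_neg (by omega)]
        simp
    · rw [Polynomial.map_sub, Polynomial.eval_sub, hF, eval_map_rename_eq_zero_of_mem hG, sub_zero]

/-- A polynomial lies in the Vandermonde ideal as soon as it vanishes under all specializations
of the variables to `k` variables. -/
theorem mem_vandermondeIdeal_of_forall_rename_eq_zero (n k : ℕ) (f : MvPolynomial (Fin n) K)
    (h : ∀ π : Fin n → Fin k, rename π f = 0) : f ∈ vandermondeIdeal K n k := by
  induction n generalizing k with
  | zero =>
    have := rename_injective (R := K) (Fin.elim0 : Fin 0 → Fin k) (fun i => i.elim0)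
    rw [(map_eq_zero_iff _ this).1 (h _)]
    exact zero_mem _
  | succ n ih =>
    rcases k with _ | k
    · have : (1 : MvPolynomial (Fin (n + 1)) K) ∈ vandermondeIdeal K (n + 1) 0 :=
        Ideal.subset_span ⟨fun _ => 0, by simp⟩
      rw [(Ideal.eq_top_iff_one _).2 this]
      trivial
    · refine mem_succVandermondeIdeal_iff.1 (mem_succVandermondeIdeal_of_eval_map_rename_eq_zero
        ih ((finSuccEquiv K n f).natDegree + 1) (fun i hi => ?_) fun π j => ?_)
      · exact Polynomial.coeff_eq_zero_of_natDegree_lt (by omega)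
      · rw [eval_map_rename_finSuccEquiv, h]

theorem mem_vandermondeIdeal_iff {f : MvPolynomial (Fin n) K} :
    f ∈ vandermondeIdeal K n k ↔ ∀ π : Fin n → Fin k, rename π f = 0 :=
  ⟨rename_eq_zero_of_mem_vandermondeIdeal, mem_vandermondeIdeal_of_forall_rename_eq_zero n k f⟩

end Vandermonde

section Depth

universe u

variable {K : Type u} [Field K] {n k : ℕ}

theorem MaximalDepthGE.quotient_map_C {R : Type u} [CommRing R] (K : Type u) [Field K] [Algebra K R]
    [Algebra.FiniteType K R] {I : Ideal R} {d : ℕ} (h : MaximalDepthGE (R ⧸ I) d) :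
    MaximalDepthGE (Polynomial R ⧸ I.map Polynomial.C) (d + 1) :=
  (h.polynomial K).of_ringEquiv I.polynomialQuotientEquivQuotientPolynomial

theorem maximalDepthGE_quotient_of_succVandermondeIdeal {d : ℕ}
    (h : MaximalDepthGE (Polynomial (MvPolynomial (Fin n) K) ⧸ succVandermondeIdeal K n k) d) :
    MaximalDepthGE (MvPolynomial (Fin (n + 1)) K ⧸ vandermondeIdeal K (n + 1) k) d :=
  h.of_ringEquiv (Ideal.quotientEquiv _ _ (finSuccEquiv K n).toRingEquiv rfl).symm

theorem vandermondeIdeal_eq_bot (h : n ≤ k) : vandermondeIdeal K n k = ⊥ := by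
  rw [eq_bot_iff]
  intro f hf
  exact (map_eq_zero_iff _ (rename_injective _ (Fin.castLE_injective h))).1
    (rename_eq_zero_of_mem_vandermondeIdeal hf _)

theorem vandermondeIdeal_succ_le : vandermondeIdeal K n (k + 1) ≤ vandermondeIdeal K n k := by
  intro f hf
  refine mem_vandermondeIdeal_iff.2 fun π => ?_
  rw [← map_eq_zero_iff _ (rename_injective (R := K) _ (Fin.castSucc_injective k)), rename_rename]
  exact rename_eq_zero_of_mem_vandermondeIdeal hf _

theorem exists_mem_succVandermondeIdeal_specialize_eq {a : Polynomial (MvPolynomial (Fin n) K)}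
    (ha : a ∈ (vandermondeIdeal K n k).map Polynomial.C) :
    ∃ b ∈ succVandermondeIdeal K n (k + 1),
      specialize K n (k + 1) b = specializeRoots K n (k + 1) * specialize K n (k + 1) a := by
  rw [vandermondeIdeal, Ideal.map_span] at ha
  induction ha using Submodule.span_induction with
  | mem a ha =>
    obtain ⟨_, ⟨g, rfl⟩, rfl⟩ := ha
    exact ⟨_, C_det_mul_prod_mem g, specialize_C_det_mul_prod g⟩
  | zero => exact ⟨0, zero_mem _, by simp⟩
  | add a b _ _ ha hb =>
    obtain ⟨r, hr, har⟩ := ha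
    obtain ⟨s, hs, hbs⟩ := hb
    exact ⟨r + s, add_mem hr hs, by rw [map_add, map_add, mul_add, har, hbs]⟩
  | smul c a _ ha =>
    obtain ⟨r, hr, har⟩ := ha
    exact ⟨c * r, Ideal.mul_mem_left _ _ hr, by
      rw [smul_eq_mul, map_mul, map_mul, har, mul_left_comm]⟩

theorem exists_mem_map_C_specialize_eq {b : Polynomial (MvPolynomial (Fin n) K)}
    (hb : b ∈ succVandermondeIdeal K n (k + 1)) :
    ∃ a ∈ (vandermondeIdeal K n k).map Polynomial.C,
      specialize K n (k + 1) b = specializeRoots K n (k + 1) * specialize K n (k + 1) a := by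
  let J : Ideal (Polynomial (MvPolynomial (Fin n) K)) :=
    { carrier := {b | ∃ a ∈ (vandermondeIdeal K n k).map Polynomial.C,
        specialize K n (k + 1) b = specializeRoots K n (k + 1) * specialize K n (k + 1) a}
      zero_mem' := ⟨0, zero_mem _, by simp⟩
      add_mem' := by
        rintro _ _ ⟨r, hr, har⟩ ⟨s, hs, hbs⟩
        exact ⟨r + s, add_mem hr hs, by rw [map_add, map_add, mul_add, har, hbs]⟩
      smul_mem' := by
        rintro c _ ⟨r, hr, har⟩
        exact ⟨c * r, Ideal.mul_mem_left _ _ hr, by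
          rw [smul_eq_mul, map_mul, map_mul, har, mul_left_comm]⟩ }
  refine (succVandermondeIdeal_le (J := J) (fun b hb => ⟨0, zero_mem _, ?_⟩) fun g =>
    ⟨_, Ideal.mem_map_of_mem _ (Ideal.subset_span ⟨g, rfl⟩), specialize_C_det_mul_prod g⟩) hb
  rw [← ker_specialize_of_mem_iff (mem_vandermondeIdeal_of_forall_rename_eq_zero _ _)] at hb
  rw [map_zero, mul_zero]
  exact hb

theorem maximalDepthGE_quotient_vandermondeIdeal (h : k ≤ n) :
    MaximalDepthGE (MvPolynomial (Fin n) K ⧸ vandermondeIdeal K n k) k := by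
  induction n generalizing k with
  | zero =>
    rw [Nat.le_zero.1 h]
    exact .zero
  | succ n ih =>
    rcases k with _ | k
    · exact .zero
    refine maximalDepthGE_quotient_of_succVandermondeIdeal ?_
    have h₁ := (ih (Nat.le_of_succ_le_succ h)).quotient_map_C K
    rcases (Nat.le_of_succ_le_succ h).eq_or_lt with rfl | hlt
    · rw [vandermondeIdeal_eq_bot le_rfl, Ideal.map_bot] at h₁
      rwa [succVandermondeIdeal, vandermondeIdeal_eq_bot le_rfl, Ideal.map_bot]
    · exact .quotient_of_mul (specialize K n (k + 1)) specializeRoots_mem_nonZeroDivisors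
        (ker_specialize_of_mem_iff (mem_vandermondeIdeal_of_forall_rename_eq_zero _ _))
        (Ideal.map_mono vandermondeIdeal_succ_le) map_C_vandermondeIdeal_le
        (fun _ ha => exists_mem_succVandermondeIdeal_specialize_eq ha)
        (fun _ hb => exists_mem_map_C_specialize_eq hb)
        ((ih hlt).quotient_map_C K) h₁

end Depth

section CohenMacaulay

theorem exists_ker_rename_le {K : Type*} [Field K] {n k : ℕ} {Q : Ideal (MvPolynomial (Fin n) K)}
    (hQ : Q.IsPrime) (h : vandermondeIdeal K n k ≤ Q) :
    ∃ π : Fin n → Fin k, RingHom.ker (rename (R := K) π) ≤ Q := by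
  obtain ⟨π, -, hπ⟩ := (Ideal.IsPrime.inf_le' (s := Finset.univ)
    (f := fun π : Fin n → Fin k => RingHom.ker (rename (R := K) π)) hQ).1 (le_trans (fun f hf =>
      mem_vandermondeIdeal_iff.2 fun π => (Submodule.mem_finsetInf.1 hf π (Finset.mem_univ _))) h)
  exact ⟨π, hπ⟩

theorem ringKrullDim_quotient_le_of_ker_rename_le {K : Type*} [Field K] {n k : ℕ} (hn : 0 < n)
    {B : Type*} [CommRing B] {f : MvPolynomial (Fin n) K →+* B} (hf : Function.Surjective f)
    {π : Fin n → Fin k} (hπ : RingHom.ker (rename (R := K) π) ≤ RingHom.ker f) :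
    ringKrullDim B ≤ k := by
  have : Nonempty (Fin n) := ⟨⟨0, hn⟩⟩
  have hdim : ringKrullDim (MvPolynomial (Fin k) K) = k := by
    rw [MvPolynomial.ringKrullDim_of_isNoetherianRing, ringKrullDim_eq_zero_of_field]
    simp
  let σ : Fin k → Fin n := Function.invFun π
  have hσ : ∀ i, π (σ (π i)) = π i := fun i => Function.invFun_eq ⟨i, rfl⟩
  rw [← hdim]
  refine ringKrullDim_le_of_surjective (f.comp (rename σ : _ →ₐ[K] _).toRingHom) fun b => ?_
  obtain ⟨p, rfl⟩ := hf b
  refine ⟨rename π p, ?_⟩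
  have hmem : rename σ (rename π p) - p ∈ RingHom.ker (rename (R := K) π) := by
    rw [RingHom.mem_ker, map_sub, rename_rename, rename_rename,
      show (π ∘ σ) ∘ π = π from funext hσ, sub_self]
  simpa [sub_eq_zero] using hπ hmem

theorem ringKrullDim_quotient_le_of_forall_isPrime {R : Type*} [CommRing R] (I : Ideal R)
    (d : WithBot ℕ∞) (h : ∀ Q : Ideal R, Q.IsPrime → I ≤ Q → ringKrullDim (R ⧸ Q) ≤ d) :
    ringKrullDim (R ⧸ I) ≤ d := by
  rw [ringKrullDim, Order.krullDim_eq_iSup_coheight]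
  refine iSup_le fun Q => ?_
  rw [Order.coheight_eq_krullDim_Ici]
  have hI : I ≤ Q.asIdeal.comap (Ideal.Quotient.mk I) := by
    rw [← Ideal.map_le_iff_le_comap, Ideal.map_quotient_self]
    exact bot_le
  refine le_trans ?_ (h _ inferInstance hI)
  exact (ringKrullDim_quotient Q.asIdeal).ge.trans (ringKrullDim_le_of_surjective
    (Ideal.quotientMap Q.asIdeal (Ideal.Quotient.mk I) le_rfl)
    (Ideal.quotientMap_surjective Ideal.Quotient.mk_surjective))

theorem ringKrullDim_quotient_vandermondeIdeal_le {K : Type*} [Field K] {n k : ℕ} (hn : 0 < n) :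
    ringKrullDim (MvPolynomial (Fin n) K ⧸ vandermondeIdeal K n k) ≤ k := by
  refine ringKrullDim_quotient_le_of_forall_isPrime _ _ fun Q hQ hle => ?_
  obtain ⟨π, hπ⟩ := exists_ker_rename_le hQ hle
  exact ringKrullDim_quotient_le_of_ker_rename_le hn Ideal.Quotient.mk_surjective
    (hπ.trans Ideal.mk_ker.ge)

theorem length_le_height_of_isWeaklyRegular {A : Type*} [CommRing A] [IsNoetherianRing A]
    {P : Ideal A} [P.IsPrime] {rs : List A} (hrs : RingTheory.Sequence.IsWeaklyRegular A rs)
    (hP : ∀ r ∈ rs, r ∈ P) : (rs.length : ℕ∞) ≤ P.height := by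
  have hreg := hrs.isRegular_of_isLocalization_of_mem (S := Localization.AtPrime P) P hP
  have hdim := ringKrullDim_add_length_eq_ringKrullDim_of_isRegular _ hreg
  rw [IsLocalization.AtPrime.ringKrullDim_eq_height P (Localization.AtPrime P)] at hdim
  have hnt : Nontrivial (Localization.AtPrime P ⧸
      Ideal.ofList (rs.map (algebraMap A (Localization.AtPrime P)))) := by
    rw [Ideal.Quotient.nontrivial_iff]
    intro h
    exact hreg.top_ne_smul (by rw [h]; simp)
  have h0 := ringKrullDim_nonneg_of_nontrivial (R := Localization.AtPrime P ⧸
      Ideal.ofList (rs.map (algebraMap A (Localization.AtPrime P))))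
  rw [List.length_map] at hdim
  rw [← WithBot.coe_le_coe, ← hdim]
  exact le_add_of_nonneg_left h0

theorem MaximalDepthGE.isCohenMacaulayRing {A : Type*} [CommRing A] [IsNoetherianRing A] {d : ℕ}
    (h : MaximalDepthGE A d) (hd : ringKrullDim A ≤ d) : IsCohenMacaulayRing A := by
  refine ⟨inferInstance, fun P hP => ?_⟩
  have hle : P.height ≤ d := by
    have := (Ideal.height_le_ringKrullDim_of_ne_top hP.ne_top).trans hd
    exact_mod_cast this
  rw [← PrimeSpectrum.height_eq_orderHeight]
  refine le_antisymm (sSup_le ?_) ?_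
  · rintro _ ⟨s, ⟨hs, hreg⟩, rfl⟩
    have := hP.isPrime
    exact length_le_height_of_isWeaklyRegular hreg.toIsWeaklyRegular hs
  · obtain ⟨rs, rfl, hmem, hrs⟩ := h P hP
    refine hle.trans (le_sSup ⟨rs, ⟨hmem, hrs, fun htop => hP.ne_top ?_⟩, rfl⟩)
    rw [smul_eq_mul, Ideal.mul_top] at htop
    exact top_le_iff.1 (htop.le.trans (Ideal.span_le.2 hmem))

end CohenMacaulay

/-- Vandermonde determinantal ideals: `R ⧸ I_{n,k}` is a Cohen–Macaulay ring. -/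
theorem vanIdeal_quotient_isCohenMacaulay (K : Type*) [Field K] (n k : ℕ)
    (hk : 1 ≤ k) (hn : k < n) :
    IsCohenMacaulayRing (MvPolynomial (Fin n) K ⧸ vanIdeal K n k) := by
  rw [vanIdeal_eq_vandermondeIdeal]
  exact (maximalDepthGE_quotient_vandermondeIdeal hn.le).isCohenMacaulayRing
    (ringKrullDim_quotient_vandermondeIdeal_le (by omega))
end

section
/- Let K be a field, n > k ≥ 1 integers, R = K[x₁,…,xₙ], and I_{n,k} the ideal generated by all (k+1)-minors of the (k+1)×n Vandermonde matrix M_{n,k}. Then the degree (multiplicity) of the standard graded ring R/I_{n,k} equals S(n,k), the Stirling number of the second kind, i.e., the number of partitions of an n-element set into k nonempty subsets. -/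
open MvPolynomial

/-- The Hilbert function of `R ⧸ I` for `R = K[x₁,…,xₙ]` standard graded:
`j ↦ dim_K (R ⧸ I)_j`, where `(R ⧸ I)_j` is the image of the space of homogeneous
polynomials of degree `j` in `R ⧸ I`. -/
noncomputable def hilbertFn (K : Type*) [Field K] {n : ℕ}
    (I : Ideal (MvPolynomial (Fin n) K)) (j : ℕ) : ℕ :=
  Module.finrank K ((MvPolynomial.homogeneousSubmodule (Fin n) K j).map
    (Ideal.Quotient.mkₐ K I).toLinearMap)

/-- `hasDegree K I e` says that the standard graded algebra `R ⧸ I` has degree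
(multiplicity) `e`: there is a (Hilbert) polynomial `P` agreeing with the Hilbert
function of `R ⧸ I` in all large degrees, and `e = (d-1)! ·` (leading coefficient
of `P`), where `d` is the Krull dimension of `R ⧸ I`. -/
def hasDegree (K : Type*) [Field K] {n : ℕ}
    (I : Ideal (MvPolynomial (Fin n) K)) (e : ℚ) : Prop :=
  ∃ (P : Polynomial ℚ) (d : ℕ),
    ringKrullDim (MvPolynomial (Fin n) K ⧸ I) = d ∧
    (∀ᶠ j : ℕ in Filter.atTop, (hilbertFn K I j : ℚ) = P.eval (j : ℚ)) ∧
    e = (d - 1).factorial * P.leadingCoeff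

/-- The Stirling number of the second kind `S(n,k)`: the number of partitions of an
`n`-element set into `k` nonempty subsets. -/
noncomputable def stirling2 (n k : ℕ) : ℕ :=
  Nat.card {P : Finpartition (Finset.univ : Finset (Fin n)) // P.parts.card = k}

/-- The ideal of polynomials vanishing after every identification of the `n` variables with
`k` variables, i.e. the vanishing ideal of the arrangement of points having at most `k` distinct
coordinates. -/
noncomputable def coincidenceIdeal (K : Type*) [Field K] (n k : ℕ) :
    Ideal (MvPolynomial (Fin n) K) :=
  ⨅ f : Fin n → Fin k, RingHom.ker (rename f : MvPolynomial (Fin n) K →ₐ[K] _)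

/-- The exponents of the standard monomials modulo `vanIdeal K n k`. -/
def IsStandardExponent : (n k : ℕ) → (Fin n →₀ ℕ) → Prop
  | 0, _, _ => True
  | _ + 1, 0, _ => False
  | n + 1, k + 1, a =>
    if a 0 < k + 1 then IsStandardExponent n (k + 1) a.tail else IsStandardExponent n k a.tail

section Coincidence

variable {K : Type*} [Field K] {n k : ℕ}

lemma mem_coincidenceIdeal {p : MvPolynomial (Fin n) K} :
    p ∈ coincidenceIdeal K n k ↔ ∀ f : Fin n → Fin k, rename f p = 0 := by
  simp [coincidenceIdeal, RingHom.mem_ker]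

lemma finSuccEquiv_rename_cons_succ (f : Fin n → Fin k) (p : MvPolynomial (Fin (n + 1)) K) :
    MvPolynomial.finSuccEquiv K k (rename (Fin.cons 0 (Fin.succ ∘ f) : Fin (n + 1) → _) p) =
      (MvPolynomial.finSuccEquiv K n p).map
        (rename f : MvPolynomial (Fin n) K →ₐ[K] _).toRingHom := by
  induction p using MvPolynomial.induction_on with
  | C a => simp [finSuccEquiv_apply]
  | add p q hp hq => simp [hp, hq]
  | mul_X p i hp =>
    cases i using Fin.cases with
    | zero => simp [hp, finSuccEquiv_X_zero]
    | succ i => simp [hp, finSuccEquiv_X_succ]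

lemma rename_cons_eq_eval (i : Fin k) (f : Fin n → Fin k) (p : MvPolynomial (Fin (n + 1)) K) :
    rename (Fin.cons i f : Fin (n + 1) → _) p =
      ((MvPolynomial.finSuccEquiv K n p).map
        (rename f : MvPolynomial (Fin n) K →ₐ[K] _).toRingHom).eval (X i) := by
  induction p using MvPolynomial.induction_on with
  | C a => simp [finSuccEquiv_apply]
  | add p q hp hq => simp [hp, hq]
  | mul_X p j hp =>
    cases j using Fin.cases with
    | zero => simp [hp, finSuccEquiv_X_zero]
    | succ j => simp [hp, finSuccEquiv_X_succ]

lemma coeff_finSuccEquiv_mem_coincidenceIdeal {p : MvPolynomial (Fin (n + 1)) K}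
    (hp : p ∈ coincidenceIdeal K (n + 1) (k + 1)) (d : ℕ) :
    (MvPolynomial.finSuccEquiv K n p).coeff d ∈ coincidenceIdeal K n k := by
  rw [mem_coincidenceIdeal] at hp ⊢
  intro f
  have h := finSuccEquiv_rename_cons_succ f p
  rw [hp, map_zero] at h
  simpa using congr(($h).coeff d).symm

lemma coeff_finSuccEquiv_mem_coincidenceIdeal_of_natDegree_lt
    {p : MvPolynomial (Fin (n + 1)) K} (hp : p ∈ coincidenceIdeal K (n + 1) k)
    (hd : (MvPolynomial.finSuccEquiv K n p).natDegree < k) (d : ℕ) :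
    (MvPolynomial.finSuccEquiv K n p).coeff d ∈ coincidenceIdeal K n k := by
  rw [mem_coincidenceIdeal] at hp ⊢
  intro f
  have h : (MvPolynomial.finSuccEquiv K n p).map
      (rename f : MvPolynomial (Fin n) K →ₐ[K] MvPolynomial (Fin k) K).toRingHom = 0 := by
    refine Polynomial.eq_zero_of_natDegree_lt_card_of_eval_eq_zero _
      (f := fun i : Fin k => (X i : MvPolynomial (Fin k) K)) (X_injective) ?_ ?_
    · intro i
      rw [← rename_cons_eq_eval, hp]
    · simpa using Polynomial.natDegree_map_le.trans_lt hd
  simpa using congr(($h).coeff d)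

lemma vanIdeal_le_coincidenceIdeal : vanIdeal K n k ≤ coincidenceIdeal K n k := by
  refine Ideal.span_le.2 ?_
  rintro _ ⟨g, rfl⟩
  refine mem_coincidenceIdeal.2 fun f => ?_
  obtain ⟨i, j, hij, h⟩ := Fintype.exists_ne_map_eq_of_card_lt (f ∘ g) (by simp)
  rw [AlgHom.map_det]
  refine Matrix.det_zero_of_column_eq hij fun l => ?_
  simp only [Function.comp_apply] at h
  simp [vandermondeMatrix, h]

lemma eq_zero_of_mem_coincidenceIdeal_of_isStandardExponent :
    ∀ (n k : ℕ) {p : MvPolynomial (Fin n) K}, p ∈ coincidenceIdeal K n k →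
      (∀ a ∈ p.support, IsStandardExponent n k a) → p = 0
  | 0, k, p, hp, _ =>
    rename_injective (Fin.elim0 : Fin 0 → Fin k) (fun i => i.elim0) (by
      rw [mem_coincidenceIdeal.1 hp, map_zero])
  | n + 1, 0, p, _, hs => by
    rw [← support_eq_empty, Finset.eq_empty_iff_forall_notMem]
    exact hs
  | n + 1, k + 1, p, hp, hs => by
    have hs' (d : ℕ) (a) (ha : a ∈ ((MvPolynomial.finSuccEquiv K n p).coeff d).support) :
        if d < k + 1 then IsStandardExponent n (k + 1) a else IsStandardExponent n k a := by
      simpa [IsStandardExponent] using hs _ (mem_support_coeff_finSuccEquiv.1 ha)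
    have h1 (d : ℕ) (hd : k + 1 ≤ d) : (MvPolynomial.finSuccEquiv K n p).coeff d = 0 := by
      refine eq_zero_of_mem_coincidenceIdeal_of_isStandardExponent n k
        (coeff_finSuccEquiv_mem_coincidenceIdeal hp d) fun a ha => ?_
      simpa [hd.not_gt] using hs' d a ha
    have hdeg : (MvPolynomial.finSuccEquiv K n p).natDegree < k + 1 :=
      Nat.lt_succ_of_le (Polynomial.natDegree_le_iff_coeff_eq_zero.2 fun d hd => h1 d hd)
    refine (map_eq_zero_iff _ (MvPolynomial.finSuccEquiv K n).injective).1
      (Polynomial.ext fun d => ?_)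
    rcases lt_or_ge d (k + 1) with hd | hd
    · refine eq_zero_of_mem_coincidenceIdeal_of_isStandardExponent n (k + 1)
        (coeff_finSuccEquiv_mem_coincidenceIdeal_of_natDegree_lt hp hdeg d) fun a ha => ?_
      simpa [hd] using hs' d a ha
    · exact h1 d hd

end Coincidence

section Spanning

variable {K : Type*} [Field K] {n k : ℕ}

lemma finSuccEquiv_rename_succ (p : MvPolynomial (Fin n) K) :
    MvPolynomial.finSuccEquiv K n (rename Fin.succ p) = Polynomial.C p := by
  induction p using MvPolynomial.induction_on with
  | C a => simp [finSuccEquiv_apply]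
  | add p q hp hq => simp [hp, hq]
  | mul_X p i hp => simp [hp, finSuccEquiv_X_succ]

lemma rename_succ_mem_vanIdeal {p : MvPolynomial (Fin n) K} (hp : p ∈ vanIdeal K n k) :
    rename Fin.succ p ∈ vanIdeal K (n + 1) k := by
  refine Ideal.span_le (I := (vanIdeal K (n + 1) k).comap
    (rename Fin.succ : MvPolynomial (Fin n) K →ₐ[K] _)) |>.2 ?_ hp
  rintro _ ⟨g, rfl⟩
  refine Ideal.subset_span ⟨g.trans (Fin.succEmb n), ?_⟩
  rw [AlgHom.map_det]
  congr 1
  ext i j : 2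
  simp [vandermondeMatrix]

/-- Every element of `vanIdeal K n k` is the coefficient of `X 0 ^ (k + 1)`, the highest possible
power of `X 0`, in some element of `vanIdeal K (n + 1) (k + 1)`. -/
lemma exists_mem_vanIdeal_coeff_eq {p : MvPolynomial (Fin n) K} (hp : p ∈ vanIdeal K n k) :
    ∃ r ∈ vanIdeal K (n + 1) (k + 1), (MvPolynomial.finSuccEquiv K n r).natDegree ≤ k + 1 ∧
      (MvPolynomial.finSuccEquiv K n r).coeff (k + 1) = p := by
  induction hp using Submodule.span_induction with
  | zero => exact ⟨0, by simp⟩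
  | add p q _ _ hp hq =>
    obtain ⟨r, hr, hrd, rfl⟩ := hp
    obtain ⟨s, hs, hsd, rfl⟩ := hq
    refine ⟨r + s, add_mem hr hs, ?_, by simp⟩
    rw [map_add]
    exact Polynomial.natDegree_add_le_of_degree_le hrd hsd
  | smul a p _ hp =>
    obtain ⟨r, hr, hrd, rfl⟩ := hp
    refine ⟨rename Fin.succ a * r, Ideal.mul_mem_left _ _ hr, ?_, ?_⟩
    · rw [map_mul, finSuccEquiv_rename_succ]
      exact (Polynomial.natDegree_C_mul_le _ _).trans hrd
    · simp [finSuccEquiv_rename_succ]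
  | mem p hp =>
    obtain ⟨g, rfl⟩ := hp
    let g' : Fin (k + 2) ↪ Fin (n + 1) :=
      ⟨Fin.cons 0 (Fin.succ ∘ g), Fin.cons_injective_iff.2
        ⟨by simp [Fin.succ_ne_zero], (Fin.succ_injective n).comp g.injective⟩⟩
    let M := (vandermondeMatrix K (n + 1) (k + 1)).submatrix id g'
    have hM (i : Fin (k + 2)) : ∃ c : MvPolynomial (Fin n) K,
        (M.submatrix i.succAbove Fin.succ).det = rename Fin.succ c ∧
        (i = Fin.last _ → c = ((vandermondeMatrix K n k).submatrix id g).det) := by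
      refine ⟨(Matrix.of fun a b => X (g b) ^ (i.succAbove a : ℕ)).det, ?_, ?_⟩
      · rw [AlgHom.map_det]
        congr 1
        ext a b : 2
        simp [M, g', vandermondeMatrix]
      · rintro rfl
        congr 1
        ext a b : 2
        simp [vandermondeMatrix]
    choose c hc hcl using hM
    have hdet : MvPolynomial.finSuccEquiv K n M.det = ∑ i : Fin (k + 2),
        Polynomial.C ((-1) ^ (i : ℕ) * c i) * Polynomial.X ^ (i : ℕ) := by
      rw [Matrix.det_succ_column_zero, map_sum]
      refine Finset.sum_congr rfl fun i _ => ?_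
      rw [hc]
      simp [M, g', vandermondeMatrix, finSuccEquiv_rename_succ, finSuccEquiv_X_zero]
    refine ⟨(-1) ^ (k + 1) * M.det,
      Ideal.mul_mem_left _ _ (Ideal.subset_span ⟨g', rfl⟩), ?_, ?_⟩
    · have : MvPolynomial.finSuccEquiv K n ((-1) ^ (k + 1) * M.det) =
          Polynomial.C ((-1) ^ (k + 1)) * MvPolynomial.finSuccEquiv K n M.det := by simp
      rw [this, hdet]
      refine (Polynomial.natDegree_C_mul_le _ _).trans
        (Polynomial.natDegree_sum_le_of_forall_le _ _ fun i _ => ?_)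
      exact (Polynomial.natDegree_C_mul_X_pow_le _ _).trans (Nat.le_of_lt_succ i.2)
    · have : MvPolynomial.finSuccEquiv K n ((-1) ^ (k + 1) * M.det) =
          Polynomial.C ((-1) ^ (k + 1)) * MvPolynomial.finSuccEquiv K n M.det := by simp
      rw [this, hdet, Polynomial.coeff_C_mul, Polynomial.finsetSum_coeff,
        Finset.sum_eq_single (Fin.last (k + 1))]
      · rw [Polynomial.coeff_C_mul_X_pow, if_pos (by simp), hcl _ rfl, Fin.val_last, ← mul_assoc,
          ← mul_pow]
        simp
      · intro i _ hi
        rw [Polynomial.coeff_C_mul_X_pow, if_neg]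
        exact fun h => hi (Fin.ext h.symm)
      · simp

lemma rename_succ_mul_X_pow_mem_restrictSupport {k' : ℕ} {p : MvPolynomial (Fin n) K} {d : ℕ}
    (hk : ∀ a, IsStandardExponent n k a → IsStandardExponent (n + 1) k' (a.cons d))
    (hp : p ∈ restrictSupport K {a | IsStandardExponent n k a}) :
    rename Fin.succ p * X 0 ^ d ∈ restrictSupport K {a | IsStandardExponent (n + 1) k' a} := by
  rw [mem_restrictSupport_iff] at hp ⊢
  intro a ha
  obtain ⟨e, b, rfl⟩ : ∃ e b, a = Finsupp.cons e b := ⟨a 0, a.tail, (Finsupp.cons_tail a).symm⟩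
  rw [Finset.mem_coe, ← mem_support_coeff_finSuccEquiv] at ha
  simp only [map_mul, finSuccEquiv_rename_succ, map_pow, finSuccEquiv_X_zero,
    Polynomial.coeff_C_mul_X_pow] at ha
  split_ifs at ha with h
  · subst h
    exact hk _ (hp ha)
  · simp at ha

lemma vanIdeal_sup_restrictSupport_eq_top : ∀ n k : ℕ,
    (vanIdeal K n k).restrictScalars K ⊔ restrictSupport K {a | IsStandardExponent n k a} = ⊤
  | 0, k => by
    refine eq_top_iff.2 (le_sup_of_le_right fun p _ => ?_)
    rw [mem_restrictSupport_iff]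
    intro a _
    trivial
  | n + 1, 0 => by
    have h : vanIdeal K (n + 1) 0 = ⊤ := by
      rw [Ideal.eq_top_iff_one]
      refine Ideal.subset_span ⟨⟨fun _ => 0, fun i j _ => Fin.ext (by omega)⟩, ?_⟩
      simp [vandermondeMatrix]
    simp [h]
  | n + 1, k + 1 => by
    set W := (vanIdeal K (n + 1) (k + 1)).restrictScalars K ⊔
      restrictSupport K {a | IsStandardExponent (n + 1) (k + 1) a} with hW
    suffices h : ∀ (N : ℕ) (p : MvPolynomial (Fin (n + 1)) K),
        (∀ i ≥ N, (MvPolynomial.finSuccEquiv K n p).coeff i = 0) → p ∈ W by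
      refine eq_top_iff.2 fun p _ => h ((MvPolynomial.finSuccEquiv K n p).natDegree + 1) p ?_
      exact fun i hi => Polynomial.coeff_eq_zero_of_natDegree_lt hi
    intro N
    induction N with
    | zero =>
      intro p hp
      have : p = 0 := (map_eq_zero_iff _ (MvPolynomial.finSuccEquiv K n).injective).1
        (Polynomial.ext fun i => hp i (Nat.zero_le i))
      exact this ▸ zero_mem W
    | succ N ih =>
      intro p hp
      suffices h : ∃ w ∈ W, (∀ i > N, (MvPolynomial.finSuccEquiv K n w).coeff i = 0) ∧
          (MvPolynomial.finSuccEquiv K n w).coeff N =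
            (MvPolynomial.finSuccEquiv K n p).coeff N by
        obtain ⟨w, hw, hw0, hwN⟩ := h
        rw [← sub_add_cancel p w]
        refine add_mem (ih _ fun i hi => ?_) hw
        rcases hi.eq_or_lt with rfl | hi
        · simp [hwN]
        · simp [hw0 i hi, hp i hi]
      generalize (MvPolynomial.finSuccEquiv K n p).coeff N = c
      rcases lt_or_ge N (k + 1) with hN | hN
      · obtain ⟨s, hs, b, hb, rfl⟩ := Submodule.mem_sup.1
          ((vanIdeal_sup_restrictSupport_eq_top n (k + 1)).ge (Submodule.mem_top (x := c)))
        refine ⟨rename Fin.succ s * X 0 ^ N + rename Fin.succ b * X 0 ^ N,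
          add_mem (Submodule.mem_sup_left ?_) (Submodule.mem_sup_right ?_), fun i hi => ?_, ?_⟩
        · exact Ideal.mul_mem_right _ _ (rename_succ_mem_vanIdeal hs)
        · refine rename_succ_mul_X_pow_mem_restrictSupport (fun a ha => ?_) hb
          simpa [IsStandardExponent, hN] using ha
        · simp [finSuccEquiv_rename_succ, finSuccEquiv_X_zero, Polynomial.coeff_X_pow, hi.ne']
        · simp [finSuccEquiv_rename_succ, finSuccEquiv_X_zero]
      · obtain ⟨s, hs, b, hb, rfl⟩ := Submodule.mem_sup.1
          ((vanIdeal_sup_restrictSupport_eq_top n k).ge (Submodule.mem_top (x := c)))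
        obtain ⟨r, hr, hrd, rfl⟩ := exists_mem_vanIdeal_coeff_eq hs
        obtain ⟨m, rfl⟩ := Nat.exists_eq_add_of_le' hN
        refine ⟨r * X 0 ^ m + rename Fin.succ b * X 0 ^ (m + (k + 1)),
          add_mem (Submodule.mem_sup_left ?_) (Submodule.mem_sup_right ?_), fun i hi => ?_, ?_⟩
        · exact Ideal.mul_mem_right _ _ hr
        · refine rename_succ_mul_X_pow_mem_restrictSupport (fun a ha => ?_) hb
          simpa [IsStandardExponent, show ¬ m + (k + 1) ≤ k by omega] using ha
        · obtain ⟨l, rfl⟩ := Nat.exists_eq_add_of_lt hi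
          have : (MvPolynomial.finSuccEquiv K n r).coeff (k + 1 + l + 1) = 0 :=
            Polynomial.coeff_eq_zero_of_natDegree_lt (by omega)
          have h2 : m + (k + 1) + l + 1 = k + 1 + l + 1 + m := by omega
          rw [map_add, map_mul, map_pow, finSuccEquiv_X_zero, Polynomial.coeff_add, h2,
            Polynomial.coeff_mul_X_pow, this]
          simp [finSuccEquiv_rename_succ, finSuccEquiv_X_zero, Polynomial.coeff_X_pow]
          omega
        · rw [map_add, map_mul, map_pow, finSuccEquiv_X_zero, Polynomial.coeff_add, add_comm m,
            Polynomial.coeff_mul_X_pow]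
          simp [finSuccEquiv_rename_succ, finSuccEquiv_X_zero]

lemma vanIdeal_eq_coincidenceIdeal : vanIdeal K n k = coincidenceIdeal K n k := by
  refine le_antisymm vanIdeal_le_coincidenceIdeal fun p hp => ?_
  obtain ⟨s, hs, b, hb, rfl⟩ := Submodule.mem_sup.1
    ((vanIdeal_sup_restrictSupport_eq_top n k).ge (Submodule.mem_top (x := p)))
  have hb' : b ∈ coincidenceIdeal K n k := by
    simpa using sub_mem hp (vanIdeal_le_coincidenceIdeal hs)
  rw [eq_zero_of_mem_coincidenceIdeal_of_isStandardExponent n k hb' hb, add_zero]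
  exact hs

end Spanning

section HilbertFunction

variable {K : Type*} [Field K]

lemma homogeneousComponent_mem_coincidenceIdeal {n k : ℕ} {p : MvPolynomial (Fin n) K}
    (hp : p ∈ coincidenceIdeal K n k) (j : ℕ) :
    homogeneousComponent j p ∈ coincidenceIdeal K n k := by
  rw [mem_coincidenceIdeal] at hp ⊢
  intro f
  rw [rename_homogeneousComponent, hp, map_zero]

lemma hilbertFn_vanIdeal (n k j : ℕ) :
    hilbertFn K (vanIdeal K n k) j =
      Nat.card {a : Fin n →₀ ℕ // IsStandardExponent n k a ∧ a.degree = j} := by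
  let S : Set (Fin n →₀ ℕ) := {a | IsStandardExponent n k a ∧ a.degree = j}
  let π := (Ideal.Quotient.mkₐ K (vanIdeal K n k)).toLinearMap
  have hS : restrictSupport K S ≤ homogeneousSubmodule (Fin n) K j := by
    rw [homogeneousSubmodule_eq_finsupp_supported]
    exact AddMonoidAlgebra.supported_mono (s := S) (t := {d | d.degree = j}) fun a ha => ha.2
  have hmap : (homogeneousSubmodule (Fin n) K j).map π = (restrictSupport K S).map π := by
    refine le_antisymm ?_ (Submodule.map_mono hS)
    rintro _ ⟨p, hp, rfl⟩
    obtain ⟨s, hs, b, hb, rfl⟩ := Submodule.mem_sup.1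
      ((vanIdeal_sup_restrictSupport_eq_top (K := K) n k).ge (Submodule.mem_top (x := p)))
    refine ⟨homogeneousComponent j b, fun a ha => ?_, ?_⟩
    · change a ∈ (homogeneousComponent j b).support at ha
      rw [support_homogeneousComponent, Finset.mem_filter] at ha
      exact ⟨hb ha.1, ha.2⟩
    · rw [← homogeneousComponent_eq_self hp, map_add, map_add, right_eq_add]
      refine Ideal.Quotient.eq_zero_iff_mem.2 ?_
      rw [vanIdeal_eq_coincidenceIdeal]
      exact homogeneousComponent_mem_coincidenceIdeal (vanIdeal_le_coincidenceIdeal hs) j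
  have hinj : Function.Injective (π.domRestrict (restrictSupport K S)) := by
    refine (injective_iff_map_eq_zero _).2 fun p hp => Subtype.ext ?_
    refine eq_zero_of_mem_coincidenceIdeal_of_isStandardExponent n k
      (vanIdeal_le_coincidenceIdeal (Ideal.Quotient.eq_zero_iff_mem.1 hp)) fun a ha => ?_
    exact (p.2 ha).1
  rw [hilbertFn, hmap, ← LinearMap.range_domRestrict, ← (LinearEquiv.ofInjective _ hinj).finrank_eq,
    Module.finrank_eq_nat_card_basis (basisRestrictSupport K S)]
  rfl

end HilbertFunction

section Counting

/-- The generating function of the number of standard monomials by degree. -/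
noncomputable def standardSeries (n k : ℕ) : PowerSeries ℚ :=
  .mk fun j => Nat.card {a : Fin n →₀ ℕ // IsStandardExponent n k a ∧ a.degree = j}

lemma finite_degree_eq (n j : ℕ) (P : (Fin n →₀ ℕ) → Prop) :
    Finite {a : Fin n →₀ ℕ // P a ∧ a.degree = j} :=
  ((Finsupp.finite_of_degree_le (σ := Fin n) j).subset fun _ ha => ha.2.le :
    Set.Finite {a | P a ∧ a.degree = j})

lemma Finsupp.degree_cons {n : ℕ} (d : ℕ) (a : Fin n →₀ ℕ) :
    (a.cons d).degree = d + a.degree := by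
  simp [Finsupp.degree_eq_sum, Fin.sum_univ_succ]

/-- Splitting off the first exponent of a standard monomial. -/
noncomputable def standardExponentEquiv (n k j : ℕ) :
    {a : Fin (n + 1) →₀ ℕ // IsStandardExponent (n + 1) (k + 1) a ∧ a.degree = j} ≃
      Σ x : Finset.HasAntidiagonal.antidiagonal j, {a : Fin n →₀ ℕ //
        (if x.1.1 < k + 1 then IsStandardExponent n (k + 1) a else IsStandardExponent n k a) ∧
          a.degree = x.1.2} where
  toFun a := ⟨⟨(a.1 0, a.1.tail.degree), by
    rw [Finset.HasAntidiagonal.mem_antidiagonal, ← Finsupp.degree_cons, Finsupp.cons_tail, a.2.2]⟩,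
    a.1.tail, a.2.1, rfl⟩
  invFun x := ⟨x.2.1.cons x.1.1.1, by
    simpa [IsStandardExponent] using x.2.2.1, by
    rw [Finsupp.degree_cons, x.2.2.2, Finset.HasAntidiagonal.mem_antidiagonal.1 x.1.2]⟩
  left_inv a := Subtype.ext (by simp)
  right_inv := by
    rintro ⟨⟨⟨d, e⟩, h⟩, ⟨a, ha, h'⟩⟩
    exact Sigma.ext (Subtype.ext (by simpa using h'))
      ((Subtype.heq_iff_coe_eq (by simp [h'])).2 (by simp))

lemma standardSeries_succ_succ (n k : ℕ) :
    standardSeries (n + 1) (k + 1) =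
      .mk (fun i => if i < k + 1 then 1 else 0) * standardSeries n (k + 1) +
        .mk (fun i => if i < k + 1 then 0 else 1) * standardSeries n k := by
  ext j
  have h_fin (x : Finset.HasAntidiagonal.antidiagonal j) := finite_degree_eq n x.1.2 fun a =>
    if x.1.1 < k + 1 then IsStandardExponent n (k + 1) a else IsStandardExponent n k a
  rw [standardSeries, PowerSeries.coeff_mk, Nat.card_congr (standardExponentEquiv n k j),
    Nat.card_sigma, map_add, PowerSeries.coeff_mul, PowerSeries.coeff_mul,
    ← Finset.sum_add_distrib, ← Finset.sum_coe_sort (Finset.HasAntidiagonal.antidiagonal j),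
    Nat.cast_sum]
  refine Finset.sum_congr rfl fun x _ => ?_
  simp only [standardSeries, PowerSeries.coeff_mk]
  split_ifs <;> simp

/-- The generating function of the standard monomials has the form `N / (1 - X) ^ k`, where
the polynomial `N` takes the Stirling number as its value at `1`. -/
lemma exists_standardSeries_mul_one_sub_X_pow : ∀ n k : ℕ, ∃ N : Polynomial ℚ,
    N.eval 1 = n.stirlingSecond k ∧
      standardSeries n k * (1 - PowerSeries.X : PowerSeries ℚ) ^ k = (N : PowerSeries ℚ)
  | 0, k => by
    refine ⟨(1 - Polynomial.X) ^ k, ?_, ?_⟩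
    · cases k <;> simp
    · have : standardSeries 0 k = 1 := by
        ext j
        rw [standardSeries, PowerSeries.coeff_mk, PowerSeries.coeff_one]
        split_ifs with hj
        · subst hj
          have : Unique {a : Fin 0 →₀ ℕ // IsStandardExponent 0 k a ∧ a.degree = 0} :=
            ⟨⟨⟨0, trivial, by simp⟩⟩, fun a => Subtype.ext (Subsingleton.elim _ _)⟩
          simp
        · have : IsEmpty {a : Fin 0 →₀ ℕ // IsStandardExponent 0 k a ∧ a.degree = j} :=
            ⟨fun a => hj (by rw [← a.2.2, Subsingleton.elim a.1 0, map_zero])⟩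
          simp
      simp [this]
  | n + 1, 0 => by
    refine ⟨0, by simp, ?_⟩
    have : standardSeries (n + 1) 0 = 0 := by
      ext j
      simp [standardSeries, IsStandardExponent]
    simp [this]
  | n + 1, k + 1 => by
    obtain ⟨N₁, h₁, e₁⟩ := exists_standardSeries_mul_one_sub_X_pow n (k + 1)
    obtain ⟨N₂, h₂, e₂⟩ := exists_standardSeries_mul_one_sub_X_pow n k
    refine ⟨(∑ i ∈ Finset.range (k + 1), Polynomial.X ^ i) * N₁ + Polynomial.X ^ (k + 1) * N₂,
      ?_, ?_⟩
    · rw [Nat.stirlingSecond_succ_succ]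
      simp [Polynomial.eval_finsetSum, h₁, h₂]
    · have hA : (PowerSeries.mk fun i => if i < k + 1 then (1 : ℚ) else 0) =
          ((∑ i ∈ Finset.range (k + 1), Polynomial.X ^ i : Polynomial ℚ) : PowerSeries ℚ) := by
        ext i
        simp [Polynomial.coeff_X_pow]
      have hB : (PowerSeries.mk fun i => if i < k + 1 then (0 : ℚ) else 1) *
          (1 - PowerSeries.X) = PowerSeries.X ^ (k + 1) := by
        ext i
        rw [mul_sub, mul_one, map_sub, PowerSeries.coeff_X_pow]
        cases i with
        | zero => simp
        | succ i =>
          rw [PowerSeries.coeff_succ_mul_X]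
          simp only [PowerSeries.coeff_mk]
          split_ifs <;> first | omega | simp
      rw [standardSeries_succ_succ, hA, add_mul, mul_assoc, e₁, pow_succ' (1 - _),
        mul_mul_mul_comm, hB, e₂]
      simp

end Counting

lemma Polynomial.coeff_hilbertPoly_succ (N : Polynomial ℚ) (d : ℕ) :
    (N.hilbertPoly (d + 1)).coeff d = N.eval 1 / d.factorial := by
  rw [hilbertPoly_succ, finsetSum_coeff, eval_eq_sum, sum_def, Finset.sum_div]
  refine Finset.sum_congr rfl fun i _ => ?_
  rw [coeff_smul, coeff_preHilbertPoly_self, smul_eq_mul, one_pow, mul_one, div_eq_mul_inv]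

lemma Polynomial.natDegree_hilbertPoly_succ_le (N : Polynomial ℚ) (d : ℕ) :
    (N.hilbertPoly (d + 1)).natDegree ≤ d := by
  rw [hilbertPoly_succ]
  refine natDegree_sum_le_of_forall_le _ _ fun i _ => (natDegree_smul_le _ _).trans ?_
  rw [natDegree_preHilbertPoly]

lemma Nat.stirlingSecond_pos : ∀ {n k : ℕ}, 1 ≤ k → k ≤ n → 0 < n.stirlingSecond k
  | 0, _, h, h' => by omega
  | n + 1, 1, _, _ => by simp [stirlingSecond_one_right]
  | n + 1, k + 2, _, h => by
    rw [stirlingSecond_succ_succ]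
    exact Nat.add_pos_right _ (stirlingSecond_pos (by omega) (by omega))

section Stirling

lemma range_part {n : ℕ} (P : Finpartition (Finset.univ : Finset (Fin n))) :
    Set.range P.part = P.parts := by
  refine Set.Subset.antisymm ?_ fun p hp => ?_
  · rintro _ ⟨a, rfl⟩
    exact P.part_mem.2 (by simp)
  · obtain ⟨a, -, ha⟩ := P.part_surjOn hp
    exact ⟨a, ha⟩

/-- Partitions of a finite type are its equivalence relations. -/
lemma bijective_ker_part (n : ℕ) : Function.Bijective
    fun P : Finpartition (Finset.univ : Finset (Fin n)) => Setoid.ker P.part := by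
  classical
  constructor
  · intro P Q h
    have hrel (a b : Fin n) : P.part a = P.part b ↔ Q.part a = Q.part b :=
      Setoid.ext_iff.1 h a b
    have hpart : P.part = Q.part := by
      ext a b
      rw [P.mem_part_iff_part_eq_part (by simp) (by simp),
        Q.mem_part_iff_part_eq_part (by simp) (by simp), hrel]
    refine Finpartition.ext (Finset.coe_injective ?_)
    rw [← range_part, ← range_part, hpart]
  · intro s
    refine ⟨Finpartition.ofSetoid s, Setoid.ext fun a b => ?_⟩
    rw [Setoid.ker_def, ← Finpartition.mem_part_iff_part_eq_part _ (by simp) (by simp),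
      Finpartition.mem_part_ofSetoid_iff_rel]
    exact ⟨s.symm', s.symm'⟩

lemma card_quotient_ker_part {n : ℕ} (P : Finpartition (Finset.univ : Finset (Fin n))) :
    Nat.card (Quotient (Setoid.ker P.part)) = P.parts.card := by
  rw [Nat.card_congr (Setoid.quotientKerEquivRange _), range_part, Nat.card_coe_set_eq,
    Set.ncard_coe_finset]

/-- The function whose kernel extends an equivalence relation `s` to one more point, which is
put into the class `o` if there is one and into a new class otherwise. -/
def extendQuotientMk {n : ℕ} (s : Setoid (Fin n)) (o : Option (Quotient s)) :
    Fin (n + 1) → Option (Quotient s) :=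
  Fin.cons o fun a => some (Quotient.mk s a)

lemma bijective_ker_extendQuotientMk (n : ℕ) : Function.Bijective
    fun x : Σ s : Setoid (Fin n), Option (Quotient s) => Setoid.ker (extendQuotientMk x.1 x.2) := by
  constructor
  · rintro ⟨s, o⟩ ⟨t, u⟩ h
    have hrel (a b : Fin (n + 1)) : extendQuotientMk s o a = extendQuotientMk s o b ↔
      extendQuotientMk t u a = extendQuotientMk t u b := Setoid.ext_iff.1 h a b
    obtain rfl : s = t := Setoid.ext fun a b => by
      simpa [extendQuotientMk, Quotient.eq] using hrel a.succ b.succ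
    have h0 (q : Quotient s) : o = some q ↔ u = some q := by
      obtain ⟨a, rfl⟩ := Quotient.exists_rep q
      simpa [extendQuotientMk] using hrel 0 a.succ
    rw [Option.ext h0]
  · intro r
    by_cases h : ∃ a : Fin n, r 0 a.succ
    · obtain ⟨c, hc⟩ := h
      refine ⟨⟨r.comap Fin.succ, some (Quotient.mk _ c)⟩, Setoid.ext fun a b => ?_⟩
      cases a using Fin.cases <;> cases b using Fin.cases <;>
        simp [Setoid.ker_def, extendQuotientMk, Quotient.eq, Setoid.comap_rel]
      · exact ⟨fun h => r.trans' hc h, fun h => r.trans' (r.symm' hc) h⟩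
      · exact ⟨fun h => r.trans' h (r.symm' hc), fun h => r.trans' h hc⟩
    · push Not at h
      refine ⟨⟨r.comap Fin.succ, none⟩, Setoid.ext fun a b => ?_⟩
      cases a using Fin.cases <;> cases b using Fin.cases <;>
        simp [Setoid.ker_def, extendQuotientMk, Quotient.eq, Setoid.comap_rel, h]
      exact fun h' => h _ (r.symm' h')

lemma card_quotient_ker_extendQuotientMk {n : ℕ} (s : Setoid (Fin n)) (o : Option (Quotient s)) :
    Nat.card (Quotient (Setoid.ker (extendQuotientMk s o))) =
      Nat.card (Quotient s) + if o = none then 1 else 0 := by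
  rw [Nat.card_congr (Setoid.quotientKerEquivRange _)]
  have hr : Set.range (extendQuotientMk s o) = insert o (Set.range some) := by
    rw [extendQuotientMk, Fin.range_cons]
    congr 1
    ext x
    simp [Quotient.exists]
  have hc : (Set.range (some : Quotient s → _)).ncard = Nat.card (Quotient s) := by
    rw [← Nat.card_coe_set_eq, Nat.card_range_of_injective (Option.some_injective _)]
  rw [hr, Nat.card_coe_set_eq]
  cases o with
  | none => rw [Set.ncard_insert_of_notMem (by simp), hc]; simp
  | some q => rw [Set.insert_eq_of_mem (by simp), hc]; simp

/-- An equivalence relation on `n + 1` points with `k + 1` classes either has the extra point as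
a class of its own, or arises by adding that point to one of `k + 1` classes. -/
noncomputable def setoidSuccEquiv (n k : ℕ) :
    {s : Setoid (Fin (n + 1)) // Nat.card (Quotient s) = k + 1} ≃
      {s : Setoid (Fin n) // Nat.card (Quotient s) = k} ⊕
        Σ s : {s : Setoid (Fin n) // Nat.card (Quotient s) = k + 1}, Quotient s.1 :=
  calc
    _ ≃ {x : Σ s : Setoid (Fin n), Option (Quotient s) //
          (Nat.card (Quotient x.1) + if x.2 = none then 1 else 0) = k + 1} :=
      ((Equiv.ofBijective _ (bijective_ker_extendQuotientMk n)).subtypeEquiv fun x => by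
        rw [← card_quotient_ker_extendQuotientMk]; rfl).symm
    _ ≃ {s : Setoid (Fin n) // Nat.card (Quotient s) = k} ⊕
          Σ s : {s : Setoid (Fin n) // Nat.card (Quotient s) = k + 1}, Quotient s.1 :=
      { toFun := fun
          | ⟨⟨s, none⟩, h⟩ => .inl ⟨s, by simpa using h⟩
          | ⟨⟨s, some q⟩, h⟩ => .inr ⟨⟨s, by simpa using h⟩, q⟩
        invFun := fun
          | .inl s => ⟨⟨s.1, none⟩, by simp [s.2]⟩
          | .inr x => ⟨⟨x.1.1, some x.2⟩, by simp [x.1.2]⟩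
        left_inv := by rintro ⟨⟨s, _ | q⟩, h⟩ <;> rfl
        right_inv := by rintro (s | x) <;> rfl }

instance {α : Type*} [Finite α] : Finite (Setoid α) :=
  .of_injective (fun s => s.r) fun _ _ h => Setoid.ext fun a b => iff_of_eq (congr_fun₂ h a b)

lemma card_setoid_eq_stirlingSecond : ∀ n k : ℕ,
    Nat.card {s : Setoid (Fin n) // Nat.card (Quotient s) = k} = n.stirlingSecond k
  | 0, k => by
    have : Unique (Setoid (Fin 0)) := ⟨⟨⊥⟩, fun s => Setoid.ext fun a => a.elim0⟩
    cases k <;> simp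
  | n + 1, 0 => by
    have (s : Setoid (Fin (n + 1))) : Nat.card (Quotient s) ≠ 0 := Nat.card_pos.ne'
    simp [this]
  | n + 1, k + 1 => by
    have := Fintype.ofFinite {s : Setoid (Fin n) // Nat.card (Quotient s) = k + 1}
    rw [Nat.card_congr (setoidSuccEquiv n k), Nat.card_sum, Nat.card_sigma,
      Finset.sum_congr rfl fun s _ => s.2, Finset.sum_const, Finset.card_univ,
      ← Nat.card_eq_fintype_card, card_setoid_eq_stirlingSecond, card_setoid_eq_stirlingSecond,
      Nat.stirlingSecond_succ_succ, smul_eq_mul, mul_comm, add_comm]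

lemma stirling2_eq_stirlingSecond (n k : ℕ) : stirling2 n k = n.stirlingSecond k := by
  rw [stirling2, ← card_setoid_eq_stirlingSecond]
  exact Nat.card_congr ((Equiv.ofBijective _ (bijective_ker_part n)).subtypeEquiv fun P => by
    rw [← card_quotient_ker_part]; rfl)

end Stirling

section KrullDim

variable {K : Type*} [Field K]

lemma ringKrullDim_quotient_ker_rename_le {n k : ℕ} (f : Fin n → Fin k) :
    ringKrullDim (MvPolynomial (Fin n) K ⧸ RingHom.ker (rename f : _ →ₐ[K] _)) ≤ k := by
  have hker : RingHom.ker (rename f : MvPolynomial (Fin n) K →ₐ[K] _) =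
      RingHom.ker (rename (Set.rangeFactorization f) : MvPolynomial (Fin n) K →ₐ[K] _) := by
    ext p
    rw [RingHom.mem_ker, RingHom.mem_ker,
      ← map_eq_zero_iff (rename (R := K) Subtype.val) (rename_injective _ Subtype.val_injective),
      rename_rename]
    rfl
  rw [hker, ringKrullDim_eq_of_ringEquiv (Ideal.quotientKerAlgEquivOfSurjective
    (rename_surjective (R := K) _ (Set.rangeFactorization_surjective (f := f)))).toRingEquiv,
    MvPolynomial.ringKrullDim_of_isNoetherianRing, ringKrullDim_eq_zero_of_field, zero_add]
  exact_mod_cast (Finite.card_subtype_le _).trans_eq (Nat.card_fin k)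

lemma ringKrullDim_quotient_coincidenceIdeal_le (n k : ℕ) :
    ringKrullDim (MvPolynomial (Fin n) K ⧸ coincidenceIdeal K n k) ≤ k := by
  rw [ringKrullDim_quotient]
  refine iSup_le fun s => ?_
  have hs : coincidenceIdeal K n k ≤ s.head.1.asIdeal := s.head.2
  obtain ⟨f, hf⟩ : ∃ f : Fin n → Fin k,
      RingHom.ker (rename f : MvPolynomial (Fin n) K →ₐ[K] _) ≤ s.head.1.asIdeal := by
    have : Finset.univ.inf (fun f : Fin n → Fin k =>
        RingHom.ker (rename f : MvPolynomial (Fin n) K →ₐ[K] _)) ≤ s.head.1.asIdeal := by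
      refine le_trans (fun p hp => mem_coincidenceIdeal.2 fun f => ?_) hs
      exact Finset.inf_le (f := fun f : Fin n → Fin k =>
        RingHom.ker (rename f : MvPolynomial (Fin n) K →ₐ[K] _)) (Finset.mem_univ f) hp
    obtain ⟨f, -, hf⟩ := (Ideal.IsPrime.inf_le' s.head.1.isPrime).1 this
    exact ⟨f, hf⟩
  refine le_trans ?_ (ringKrullDim_quotient_ker_rename_le (K := K) f)
  rw [ringKrullDim_quotient]
  exact Order.LTSeries.length_le_krullDim
    ⟨s.length, fun i => ⟨(s i).1, hf.trans (s.head_le i)⟩, fun i => s.step i⟩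

lemma le_ringKrullDim_quotient_coincidenceIdeal {n k : ℕ} (hk : 1 ≤ k) (hn : k ≤ n) :
    k ≤ ringKrullDim (MvPolynomial (Fin n) K ⧸ coincidenceIdeal K n k) := by
  have : NeZero k := ⟨by omega⟩
  have hsurj : Function.Surjective (rename (R := K) (Fin.ofNat k ∘ ((↑) : Fin n → ℕ))) :=
    rename_surjective _ fun i => ⟨i.castLE hn, by simp⟩
  let F := Ideal.Quotient.lift (coincidenceIdeal K n k)
    (rename (R := K) (Fin.ofNat k ∘ ((↑) : Fin n → ℕ))).toRingHom
    fun p hp => mem_coincidenceIdeal.1 hp _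
  have := ringKrullDim_le_of_surjective F (Ideal.Quotient.lift_surjective_of_surjective _ _ hsurj)
  rwa [MvPolynomial.ringKrullDim_of_isNoetherianRing, ringKrullDim_eq_zero_of_field, zero_add,
    Nat.card_fin] at this

lemma ringKrullDim_quotient_vanIdeal {n k : ℕ} (hk : 1 ≤ k) (hn : k ≤ n) :
    ringKrullDim (MvPolynomial (Fin n) K ⧸ vanIdeal K n k) = k := by
  rw [vanIdeal_eq_coincidenceIdeal]
  exact le_antisymm (ringKrullDim_quotient_coincidenceIdeal_le n k)
    (le_ringKrullDim_quotient_coincidenceIdeal hk hn)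

end KrullDim

/-- The degree (multiplicity) of the standard graded ring `R ⧸ I_{n,k}` equals the
Stirling number of the second kind `S(n,k)`. -/
theorem vanIdeal_degree (K : Type*) [Field K] (n k : ℕ) (hk : 1 ≤ k) (hn : k < n) :
    hasDegree K (vanIdeal K n k) (stirling2 n k) := by
  obtain ⟨N, hN, hseries⟩ := exists_standardSeries_mul_one_sub_X_pow n k
  refine ⟨N.hilbertPoly k, k, ringKrullDim_quotient_vanIdeal hk hn.le, ?_, ?_⟩
  · have hS : standardSeries n k = N * PowerSeries.invOneSubPow ℚ k := by
      rw [← hseries, ← PowerSeries.invOneSubPow_inv_eq_one_sub_pow, mul_assoc, Units.inv_val,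
        mul_one]
    filter_upwards [Filter.eventually_gt_atTop N.natDegree] with j hj
    rw [hilbertFn_vanIdeal, ← Polynomial.coeff_mul_invOneSubPow_eq_hilbertPoly_eval k hj, ← hS,
      standardSeries, PowerSeries.coeff_mk]
  · obtain ⟨d, rfl⟩ := Nat.exists_eq_add_of_le' hk
    have hcoeff := N.coeff_hilbertPoly_succ d
    rw [hN] at hcoeff
    have hpos : (0 : ℚ) < n.stirlingSecond (d + 1) := by
      exact_mod_cast Nat.stirlingSecond_pos hk hn.le
    have hfact : (d.factorial : ℚ) ≠ 0 := by exact_mod_cast d.factorial_ne_zero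
    have hdeg : (N.hilbertPoly (d + 1)).natDegree = d :=
      (N.natDegree_hilbertPoly_succ_le d).antisymm
        (Polynomial.le_natDegree_of_ne_zero (by rw [hcoeff]; positivity))
    rw [Polynomial.leadingCoeff, hdeg, hcoeff, stirling2_eq_stirlingSecond, Nat.add_sub_cancel,
      mul_div_cancel₀ _ hfact]
end
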